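/- arXiv:1304.5342 — 5 statements merged into one kernel-verified Lean document; each statement's English description precedes it below -/
import Mathlib

section
/- Let G be a connected finite simple graph with at least 3 vertices, at least 5 edges, and h_G < N_G/2. Then [X_G]_q ≡ 0 (mod q³) for every prime power q; that is, the c2-invariant of G vanishes. -/
open scoped Classical
open Matrix

/-- The graph polynomial (Kirchhoff polynomial) of a finite simple graph `G`:
`Ψ_G = Σ_T Π_{e ∉ T} x_e`, summed over spanning trees `T` of `G`. -/
noncomputable def graphPoly {V : Type*} [Fintype V] (G : SimpleGraph V) :
    MvPolynomial G.edgeSet ℤ :=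
  letI : Fintype G.edgeSet := Fintype.ofFinite _
  ∑ T : Finset G.edgeSet,
    if (SimpleGraph.fromEdgeSet (Subtype.val '' (T : Set G.edgeSet))).IsTree then
      ∏ e ∈ Tᶜ, MvPolynomial.X e
    else 0

/-- `[X_G]_q`: the number of points `x ∈ K^{E(G)}` with `Ψ_G(x) = 0`. -/
noncomputable def Xcount {V : Type*} [Fintype V] (G : SimpleGraph V)
    (K : Type*) [CommRing K] : ℕ :=
  Nat.card {x : G.edgeSet → K // MvPolynomial.aeval x (graphPoly G) = 0}


theorem cb_aux {m n R : Type*} [Fintype m] [Fintype n] [CommRing R]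
    (C : Matrix n m R) (B : Matrix m n R) :
    (C * B).det = ∑ s ∈ (Finset.univ : Finset m).powersetCard (Fintype.card n),
      ((B * C).submatrix (Subtype.val : s → m) (Subtype.val : s → m)).det := by
  rw [← Matrix.coeff_det_one_add_X_smul_eq_sum_minors]
  have h1 : (1 + (Polynomial.X : Polynomial R) • (B * C).map Polynomial.C).det
      = (1 + (Polynomial.X : Polynomial R) • (C * B).map Polynomial.C).det := by
    rw [Matrix.map_mul, Matrix.map_mul, ← Matrix.smul_mul, Matrix.det_one_add_mul_comm,
      Matrix.mul_smul]
  rw [h1, Matrix.coeff_det_one_add_X_smul_eq_sum_minors, ← Finset.card_univ,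
    Finset.powersetCard_self, Finset.sum_singleton]
  exact (Matrix.det_submatrix_equiv_self (Equiv.subtypeUnivEquiv (by simp)) (C * B)).symm

theorem bord_aux {m n F : Type*} [Fintype m] [Fintype n] [Field F]
    (A : Matrix m n F) (x : m → F) (hx : ∀ i, x i ≠ 0) :
    (fromBlocks (diagonal x) A Aᵀ 0).det = (-1) ^ (Fintype.card n) *
      ∑ s ∈ (Finset.univ : Finset m).powersetCard (Fintype.card n),
        (∏ i ∈ sᶜ, x i) *
        ((A * Aᵀ).submatrix (Subtype.val : s → m) (Subtype.val : s → m)).det := by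
  have : Invertible (diagonal x) := by
    refine ⟨diagonal (fun i => (x i)⁻¹), ?_, ?_⟩ <;>
    · rw [diagonal_mul_diagonal]
      simp [hx]
  have hinv : ⅟(diagonal x) = diagonal (fun i => (x i)⁻¹) := by
    apply invOf_eq_right_inv
    rw [diagonal_mul_diagonal]
    simp [hx]
  rw [det_fromBlocks₁₁, zero_sub, det_neg, hinv, det_diagonal, Matrix.mul_assoc, cb_aux,
    mul_left_comm, Finset.mul_sum]
  congr 1
  refine Finset.sum_congr rfl fun s _ => ?_
  have : ((diagonal (fun i => (x i)⁻¹) * A * Aᵀ).submatrix (Subtype.val : s → m)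
      (Subtype.val : s → m)) = diagonal (fun i : s => (x i)⁻¹) *
      ((A * Aᵀ).submatrix (Subtype.val : s → m) (Subtype.val : s → m)) := by
    ext i j
    simp [Matrix.mul_assoc, diagonal_mul]
  rw [this, det_mul, det_diagonal, ← mul_assoc]
  congr 1
  rw [Finset.univ_eq_attach, Finset.prod_attach s (fun i => (x i)⁻¹), ← Finset.prod_mul_prod_compl s x,
    Finset.prod_inv_distrib]
  have : ∏ i ∈ s, x i ≠ 0 := Finset.prod_ne_zero_iff.2 fun i _ => hx i
  field_simp

theorem bord {m n F : Type*} [Fintype m] [Fintype n] [Field F]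
    (A : Matrix m n F) (x : m → F) :
    (fromBlocks (diagonal x) A Aᵀ 0).det = (-1) ^ (Fintype.card n) *
      ∑ s ∈ (Finset.univ : Finset m).powersetCard (Fintype.card n),
        (∏ i ∈ sᶜ, x i) *
        ((A * Aᵀ).submatrix (Subtype.val : s → m) (Subtype.val : s → m)).det := by
  let P := MvPolynomial m F
  let Q := FractionRing P
  have key : (fromBlocks (diagonal (fun i => (MvPolynomial.X i : P)))
        (A.map (MvPolynomial.C : F →+* P)) (A.map (MvPolynomial.C : F →+* P))ᵀ 0).det
       = (-1) ^ (Fintype.card n) *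
      ∑ s ∈ (Finset.univ : Finset m).powersetCard (Fintype.card n),
        (∏ i ∈ sᶜ, (MvPolynomial.X i : P)) *
        MvPolynomial.C ((A * Aᵀ).submatrix (Subtype.val : s → m) (Subtype.val : s → m)).det := by
    apply IsFractionRing.injective P Q
    have := bord_aux (A.map ((algebraMap P Q).comp (MvPolynomial.C : F →+* P)))
      (fun i => algebraMap P Q (MvPolynomial.X i)) (by
        intro i h
        rw [map_eq_zero_iff _ (IsFractionRing.injective P Q)] at h
        exact MvPolynomial.X_ne_zero i h)
    rw [RingHom.map_det]
    convert this using 1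
    · congr 1
      ext (i|i) (j|j) <;> simp [diagonal_apply] <;> split_ifs <;> simp
    · simp only [map_mul, map_pow, map_neg, map_one, map_sum, map_prod]
      congr 1
      refine Finset.sum_congr rfl fun s _ => ?_
      congr 1
      rw [← RingHom.comp_apply, RingHom.map_det]
      congr 1
      ext i j
      simp [Matrix.mul_apply]
  have := congrArg (MvPolynomial.eval x) key
  rw [RingHom.map_det] at this
  convert this using 1
  · congr 1
    ext (i|i) (j|j) <;> simp [diagonal_apply] <;> split_ifs <;> simp
  · simp

theorem dvd_card_sub {K M : Type*} [Field K] [Fintype K] [AddCommGroup M] [Module K M]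
    [FiniteDimensional K M] (k : ℕ) (h : k ≤ Module.finrank K M) :
    Fintype.card K ^ k ∣ Nat.card M := by
  rw [Module.natCard_eq_pow_finrank (K := K), Nat.card_eq_fintype_card]
  exact pow_dvd_pow _ h

/-- multiplication by y, mod W -/
noncomputable def mulQ {ι K : Type*} [Fintype ι] [Field K] (W : Submodule K (ι → K))
    (y : ι → K) : (ι → K) →ₗ[K] ((ι → K) ⧸ W) :=
  W.mkQ ∘ₗ LinearMap.mulRight K y

theorem mulQ_eq_zero {ι K : Type*} [Fintype ι] [Field K] (W : Submodule K (ι → K))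
    (x y : ι → K) : mulQ W y x = 0 ↔ x * y ∈ W := by
  simp [mulQ]

theorem single_count {ι K : Type*} [Fintype ι] [Field K] [Fintype K] (W : Submodule K (ι → K))
    (hW : 3 ≤ Module.finrank K W) (y : ι → K) :
    Fintype.card K ^ 3 ∣ Nat.card {x : ι → K // x * y ∈ W} := by
  have h1 : Nat.card {x : ι → K // x * y ∈ W} = Nat.card (LinearMap.ker (mulQ W y)) := by
    apply Nat.card_congr
    exact Equiv.subtypeEquivRight fun x => by simp [mulQ_eq_zero]
  rw [h1]
  apply dvd_card_sub
  have h2 := LinearMap.finrank_range_add_finrank_ker (mulQ W y)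
  have h3 := Submodule.finrank_quotient_add_finrank W
  have h4 := Submodule.finrank_le (LinearMap.range (mulQ W y))
  omega

theorem pair_count {ι K : Type*} [Fintype ι] [Field K] [Fintype K] (Z W : Submodule K (ι → K))
    (hZW : ∀ z ∈ Z, ∀ w ∈ W, z ⬝ᵥ w = 0)
    (hW : Fintype.card ι < 2 * Module.finrank K W) (y y' : ι → K)
    (hy : y ∈ Z) (hy' : y' ∈ Z) (hy0 : y ≠ 0) :
    Fintype.card K ^ 2 ∣ Nat.card {x : ι → K // x * y ∈ W ∧ x * y' ∈ W} := by
  let φ := (mulQ W y).prod (mulQ W y')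
  have h1 : Nat.card {x : ι → K // x * y ∈ W ∧ x * y' ∈ W} = Nat.card (LinearMap.ker φ) := by
    apply Nat.card_congr
    exact Equiv.subtypeEquivRight fun x => by simp [φ, mulQ_eq_zero, LinearMap.ker_prod]
  rw [h1]
  apply dvd_card_sub
  have h2 := LinearMap.finrank_range_add_finrank_ker φ
  have h3 := Submodule.finrank_quotient_add_finrank W
  have h5 : LinearMap.range φ < ⊤ := by
    rw [lt_top_iff_ne_top]
    intro htop
    obtain ⟨i, hi⟩ := Function.ne_iff.1 hy0
    have : ((0 : (ι → K) ⧸ W), W.mkQ (Pi.single i 1)) ∈ LinearMap.range φ := by simp [htop]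
    obtain ⟨x, hx⟩ := this
    have ha : mulQ W y x = 0 := congrArg Prod.fst hx
    have hb : mulQ W y' x = W.mkQ (Pi.single i 1) := congrArg Prod.snd hx
    rw [mulQ_eq_zero] at ha
    have hb' : x * y' - Pi.single i 1 ∈ W := by
      rw [← Submodule.Quotient.mk_eq_zero, Submodule.Quotient.mk_sub, sub_eq_zero]
      simpa [mulQ] using hb
    have e1 := hZW _ hy' _ ha
    have e2 := hZW _ hy _ hb'
    rw [dotProduct_sub, dotProduct_single_one] at e2
    have e3 : y' ⬝ᵥ (x * y) = y ⬝ᵥ (x * y') := by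
      simp only [dotProduct, Pi.mul_apply]
      exact Finset.sum_congr rfl fun _ _ => by ring
    rw [← e3, e1, zero_sub, neg_eq_zero] at e2
    exact hi e2
  have h4 := Submodule.finrank_lt h5.ne
  rw [Module.finrank_prod] at h4
  rw [Module.finrank_fintype_fun_eq_card] at h2 h3
  omega

theorem sum_inv {K M : Type*} [Field K] [Fintype K] [AddCommGroup M] [Module K M] [Fintype M]
    (y : M) (hy : y ≠ 0) (f : M → ℕ) (d : ℕ) (hd : ∀ z, d ∣ f z)
    (hf : ∀ z (t : K), f (z + t • y) = f z) : Fintype.card K * d ∣ ∑ z, f z := by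
  obtain ⟨Q, hQ⟩ := Submodule.exists_isCompl (K ∙ y)
  have hcard : Fintype.card (K ∙ y) = Fintype.card K := by
    have : Module.finrank K (K ∙ y) = 1 := finrank_span_singleton hy
    have h2 := Module.natCard_eq_pow_finrank (K := K) (V := (K ∙ y))
    rw [this, pow_one] at h2
    simpa [Nat.card_eq_fintype_card] using h2
  rw [← Equiv.sum_comp (Submodule.prodEquivOfIsCompl _ _ hQ).toEquiv f, Fintype.sum_prod_type]
  have : ∀ a : (K ∙ y), ∑ b : Q, f ((Submodule.prodEquivOfIsCompl _ _ hQ).toEquiv (a, b))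
      = ∑ b : Q, f b := by
    rintro ⟨a, ha⟩
    obtain ⟨t, rfl⟩ := Submodule.mem_span_singleton.1 ha
    refine Finset.sum_congr rfl fun b _ => ?_
    rw [← hf b t]
    congr 1
    simp [add_comm]
  rw [Finset.sum_congr rfl fun a _ => this a, Finset.sum_const, Finset.card_univ, hcard,
    smul_eq_mul]
  exact mul_dvd_mul_left _ (Finset.dvd_sum fun b _ => hd b)

theorem count_main {ι K : Type*} [Fintype ι] [Field K] [Fintype K] (Z W : Submodule K (ι → K))
    (hZW : ∀ z ∈ Z, ∀ w ∈ W, z ⬝ᵥ w = 0)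
    (hW3 : 3 ≤ Module.finrank K W)
    (hW : Fintype.card ι < 2 * Module.finrank K W) :
    Fintype.card K ^ 3 ∣ Nat.card {x : ι → K // ∃ y ∈ Z, y ≠ 0 ∧ x * y ∈ W} := by
  set q := Fintype.card K with hq
  let I : (ι → K) → Z → ℕ := fun x y => if x * (y : ι → K) ∈ W then 1 else 0
  let c : (ι → K) → ℕ := fun x => ∑ y, I x y
  have hI0 : ∀ x, I x 0 = 1 := fun x => by simp [I]
  have hIs : ∀ x, c x = (∑ y ∈ Finset.univ.erase (0 : Z), I x y) + 1 := fun x => by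
    rw [← hI0 x, Finset.sum_erase_add _ _ (Finset.mem_univ _)]
  -- first sum
  have S1 : q ^ 3 ∣ ∑ x, ∑ y ∈ Finset.univ.erase (0 : Z), I x y := by
    rw [Finset.sum_comm]
    refine Finset.dvd_sum fun y _ => ?_
    have := single_count W hW3 (y : ι → K)
    rw [Nat.card_eq_fintype_card, Fintype.card_subtype, Finset.card_filter] at this
    exact this
  have S2 : q ^ 3 ∣ ∑ x, ∑ y ∈ Finset.univ.erase (0 : Z), I x y * c x := by
    rw [Finset.sum_comm]
    refine Finset.dvd_sum fun y hy => ?_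
    have hy0 : y ≠ 0 := (Finset.mem_erase.1 hy).1
    simp only [c, Finset.mul_sum]
    rw [Finset.sum_comm, pow_succ']
    apply sum_inv (K := K) y hy0
    · intro z
      have := pair_count Z W hZW hW y z y.2 z.2 (by simpa using hy0)
      rw [Nat.card_eq_fintype_card, Fintype.card_subtype, Finset.card_filter] at this
      simpa only [I, ← ite_and, ite_mul_ite, mul_one, mul_zero, ite_mul, one_mul, zero_mul] using this
    · intro z t
      refine Finset.sum_congr rfl fun x _ => ?_
      simp only [I]
      by_cases h : x * (y : ι → K) ∈ W
      · have : x * ((z + t • y : Z) : ι → K) ∈ W ↔ x * (z : ι → K) ∈ W := by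
          have h2 : x * ((z + t • y : Z) : ι → K) = x * (z : ι → K) + t • (x * (y : ι → K)) := by
            simp [mul_add]
          rw [h2]
          exact W.add_mem_iff_left (W.smul_mem t h)
        simp only [this]
      · simp [h]
  have hpow : ∀ x, ∃ k : ℕ, c x = q ^ k := by
    intro x
    let S : Submodule K Z := W.comap ((LinearMap.mulLeft K x).comp Z.subtype)
    refine ⟨Module.finrank K S, ?_⟩
    have h2 := Module.natCard_eq_pow_finrank (K := K) (V := S)
    rw [Nat.card_eq_fintype_card (α := K)] at h2
    rw [← h2]
    have : Nat.card S = Nat.card {y : Z // x * (y : ι → K) ∈ W} := rfl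
    rw [this, Nat.card_eq_fintype_card, Fintype.card_subtype, Finset.card_filter]
  have hzero : ∀ x, (∃ y ∈ Z, y ≠ 0 ∧ x * y ∈ W) ↔ c x ≠ 1 := by
    intro x
    rw [hIs]
    constructor
    · rintro ⟨y, hy, h0, h1⟩ h
      have h' : ∑ y ∈ Finset.univ.erase (0 : Z), I x y = 0 := by omega
      rw [Finset.sum_eq_zero_iff] at h'
      have := h' ⟨y, hy⟩ (by simpa using h0)
      simp [I, h1] at this
    · intro h
      have h' : ∑ y ∈ Finset.univ.erase (0 : Z), I x y ≠ 0 := by omega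
      obtain ⟨y, hy, hy2⟩ := Finset.exists_ne_zero_of_sum_ne_zero h'
      refine ⟨y, y.2, by simpa using hy, ?_⟩
      by_contra h3
      simp [I, h3] at hy2
  have hid : ∀ x, (q : ℤ) ^ 3 ∣ ((q : ℤ) - 1) * ((q : ℤ) ^ 2 - 1) * (if c x ≠ 1 then 1 else 0)
      - (((q : ℤ) ^ 2 + q - 1) * (c x - 1) - (c x - 1) * c x) := by
    intro x
    have hq1 : 1 < q := Fintype.one_lt_card
    obtain ⟨k, hk⟩ := hpow x
    rcases k with _ | _ | _ | k
    · simp [hk]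
    · have : q ^ (0 + 1) ≠ 1 := by simp; omega
      rw [if_pos (by rw [hk]; exact this), hk]
      push_cast
      exact ⟨0, by ring⟩
    · have : q ^ (0 + 1 + 1) ≠ 1 := by simp; omega
      rw [if_pos (by rw [hk]; exact this), hk]
      push_cast
      exact ⟨0, by ring⟩
    · have : q ^ (k + 3) ≠ 1 := (Nat.one_lt_pow (by omega) hq1).ne'
      rw [if_pos (by rw [hk]; exact this), hk]
      push_cast
      refine ⟨1 + (q : ℤ) ^ k * (q ^ (k + 3) - q - q ^ 2), ?_⟩
      ring
  have htot : (q : ℤ) ^ 3 ∣ ((q : ℤ) - 1) * ((q : ℤ) ^ 2 - 1) *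
      (Nat.card {x : ι → K // ∃ y ∈ Z, y ≠ 0 ∧ x * y ∈ W} : ℕ) := by
    have hs := Finset.dvd_sum (s := Finset.univ) fun x _ => hid x
    rw [Finset.sum_sub_distrib, Finset.sum_sub_distrib, ← Finset.mul_sum, ← Finset.mul_sum] at hs
    have e1 : (∑ x, (if c x ≠ 1 then 1 else 0 : ℤ)) =
        (Nat.card {x : ι → K // ∃ y ∈ Z, y ≠ 0 ∧ x * y ∈ W} : ℕ) := by
      simp only [hzero]
      rw [Nat.card_eq_fintype_card, Fintype.card_subtype, Finset.card_filter]
      push_cast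
      rfl
    have e2 : ∀ x, (c x : ℤ) - 1 = ((∑ y ∈ Finset.univ.erase (0 : Z), I x y : ℕ) : ℤ) := by
      intro x
      rw [hIs]
      push_cast
      ring
    rw [e1] at hs
    have d1 : (q : ℤ) ^ 3 ∣ ∑ x, ((c x : ℤ) - 1) := by
      simp only [e2]
      exact_mod_cast S1
    have d2 : (q : ℤ) ^ 3 ∣ ∑ x, ((c x : ℤ) - 1) * c x := by
      simp only [e2]
      simp only [← Finset.sum_mul] at S2
      exact_mod_cast S2
    exact (dvd_sub_left (dvd_sub (Dvd.dvd.mul_left d1 _) d2)).1 hs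
  have hcop : IsCoprime ((q : ℤ) ^ 3) (((q : ℤ) - 1) * ((q : ℤ) ^ 2 - 1)) := by
    apply IsCoprime.pow_left
    exact ⟨-(q : ℤ) ^ 2 + q + 1, 1, by ring⟩
  exact_mod_cast hcop.dvd_of_dvd_mul_left htot

/-- extension of a vector by zero at the root -/
noncomputable def ext0 {V R : Type*} [Zero R] (r : V) (w : {v : V // v ≠ r} → R) (v : V) : R :=
  if h : v ≠ r then w ⟨v, h⟩ else 0

/-- reduced oriented incidence matrix -/
noncomputable def incA {V : Type*} (G : SimpleGraph V) (r : V) (R : Type*) [CommRing R] :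
    Matrix G.edgeSet {v : V // v ≠ r} R :=
  fun e v => (if v.1 = (Quot.out e.1).1 then 1 else 0) - (if v.1 = (Quot.out e.1).2 then 1 else 0)

theorem incA_mulVec {V R : Type*} [Fintype V] (G : SimpleGraph V) (r : V) [CommRing R]
    (w : {v : V // v ≠ r} → R) (e : G.edgeSet) :
    (incA G r R *ᵥ w) e = ext0 r w (Quot.out e.1).1 - ext0 r w (Quot.out e.1).2 := by
  have h : ∀ a : V, ∑ v : {v : V // v ≠ r}, (if v.1 = a then (1 : R) else 0) * w v = ext0 r w a := by
    intro a
    unfold ext0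
    split_ifs with ha
    · rw [Finset.sum_eq_single ⟨a, ha⟩]
      · simp
      · intro b _ hb
        rw [if_neg, zero_mul]
        exact fun h => hb (Subtype.ext h)
      · simp
    · refine Finset.sum_eq_zero fun b _ => ?_
      rw [if_neg, zero_mul]
      intro h
      exact b.2 (by rw [h]; simpa using ha)
  simp only [mulVec, dotProduct, incA, sub_mul, Finset.sum_sub_distrib, h]

theorem out_adj {V : Type*} (e : Sym2 V) : s((Quot.out e).1, (Quot.out e).2) = e := Quot.out_eq e

/-- kernel of incidence: equal along edges -/
theorem incA_edge {V R : Type*} [Fintype V] (G : SimpleGraph V) (r : V) [CommRing R]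
    (w : {v : V // v ≠ r} → R) (e : G.edgeSet) (a b : V) (hab : e.1 = s(a, b)) :
    (incA G r R *ᵥ w) e = 0 ↔ ext0 r w a = ext0 r w b := by
  rw [incA_mulVec, sub_eq_zero]
  have := out_adj e.1
  rw [hab, Sym2.eq_iff] at this
  rcases this with ⟨h1, h2⟩ | ⟨h1, h2⟩
  · rw [hab, h1, h2]
  · rw [hab, h1, h2]
    exact eq_comm

theorem reach_const {V α : Type*} (H : SimpleGraph V) (f : V → α)
    (h : ∀ a b, H.Adj a b → f a = f b) (a b : V) (hab : H.Reachable a b) : f a = f b := by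
  obtain ⟨p⟩ := hab
  induction p with
  | nil => rfl
  | cons hadj _ ih => exact (h _ _ hadj).trans ih

theorem incA_inj {V R : Type*} [Fintype V] (G : SimpleGraph V) (hG : G.Connected) (r : V)
    [CommRing R] (w : {v : V // v ≠ r} → R) (h : incA G r R *ᵥ w = 0) : w = 0 := by
  funext v
  have := reach_const G (ext0 r w) (fun a b hab => by
    rw [← incA_edge G r w ⟨s(a, b), hab⟩ a b rfl, h]; rfl) v.1 r (hG.preconnected _ _)
  simpa [ext0, v.2] using this

abbrev tgraph {V : Type*} (G : SimpleGraph V) (T : Finset G.edgeSet) : SimpleGraph V :=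
  SimpleGraph.fromEdgeSet (Subtype.val '' (T : Set G.edgeSet))

theorem tgraph_edgeSet {V : Type*} (G : SimpleGraph V) (T : Finset G.edgeSet) :
    (tgraph G T).edgeSet = Subtype.val '' (T : Set G.edgeSet) := by
  rw [SimpleGraph.edgeSet_fromEdgeSet]
  ext e
  simp only [Set.mem_sdiff, and_iff_left_iff_imp]
  rintro ⟨e, _, rfl⟩ h
  exact G.not_isDiag_of_mem_edgeSet e.2 h

theorem tgraph_card {V : Type*} (G : SimpleGraph V) (T : Finset G.edgeSet) :
    Nat.card (tgraph G T).edgeSet = T.card := by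
  rw [tgraph_edgeSet, Nat.card_image_of_injective Subtype.val_injective]
  simp

theorem tgraph_tree {V : Type*} [Fintype V] (G : SimpleGraph V) (T : Finset G.edgeSet) :
    (tgraph G T).IsTree ↔ (tgraph G T).Connected ∧ T.card + 1 = Fintype.card V := by
  rw [SimpleGraph.isTree_iff_connected_and_card, tgraph_card, Nat.card_eq_fintype_card]

theorem minor_int {V : Type*} [Fintype V] (G : SimpleGraph V) (r : V) (T : Finset G.edgeSet)
    (hT : T.card = Fintype.card {v : V // v ≠ r}) :
    ((incA G r ℤ * (incA G r ℤ)ᵀ).submatrix (Subtype.val : T → G.edgeSet)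
      (Subtype.val : T → G.edgeSet)).det = if (tgraph G T).IsTree then 1 else 0 := by
  have hV : Fintype.card {v : V // v ≠ r} + 1 = Fintype.card V := by
    have := Fintype.card_pos_iff.2 ⟨r⟩
    rw [Fintype.card_subtype_compl, Fintype.card_subtype_eq]
    omega
  have g : {v : V // v ≠ r} ≃ T := Fintype.equivOfCardEq (by simp [hT])
  let B : Matrix {v : V // v ≠ r} {v : V // v ≠ r} ℤ :=
    (incA G r ℤ).submatrix (fun v => (g v).1) id
  have hB : ((incA G r ℤ * (incA G r ℤ)ᵀ).submatrix (Subtype.val : T → G.edgeSet)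
      (Subtype.val : T → G.edgeSet)).det = B.det ^ 2 := by
    rw [← Matrix.det_submatrix_equiv_self g, pow_two]
    nth_rw 2 [← det_transpose B]
    rw [← det_mul]
    rfl
  have hBv : ∀ w v, (B *ᵥ w) v = (incA G r ℤ *ᵥ w) (g v).1 := fun w v => rfl
  rw [hB]
  split_ifs with htree
  · have hconn := ((tgraph_tree G T).1 htree).1
    have hsurj : Function.Surjective (fun u => u ᵥ* B) := by
      have hr : LinearMap.range B.vecMulLinear = ⊤ := by
        -- basis vectors
        let δ : V → ({v : V // v ≠ r} → ℤ) := fun a v => if v.1 = a then 1 else 0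
        have hδ : ∀ a b, (tgraph G T).Adj a b → δ a - δ b ∈ LinearMap.range B.vecMulLinear := by
          intro a b hab
          rw [SimpleGraph.fromEdgeSet_adj] at hab
          obtain ⟨⟨e, heT, hab⟩, _⟩ := hab
          have hrow : δ (Quot.out e.1).1 - δ (Quot.out e.1).2 ∈ LinearMap.range B.vecMulLinear := by
            refine ⟨Pi.single (g.symm ⟨e, heT⟩) 1, ?_⟩
            ext v
            simp [B, incA, δ]
          have := out_adj e.1
          rw [hab, Sym2.eq_iff] at this
          rcases this with ⟨h1, h2⟩ | ⟨h1, h2⟩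
          · rw [hab, h1, h2] at hrow
            exact hrow
          · rw [hab, h1, h2] at hrow
            rw [← neg_sub]
            exact Submodule.neg_mem _ hrow
        have hmem : ∀ a, δ a ∈ LinearMap.range B.vecMulLinear := by
          intro a
          have := reach_const (tgraph G T) (fun a => (LinearMap.range B.vecMulLinear).mkQ (δ a))
            (fun a b hab => by
              have := hδ a b hab
              rw [← sub_eq_zero, ← map_sub, Submodule.mkQ_apply, Submodule.Quotient.mk_eq_zero]
              exact this) a r (hconn.preconnected _ _)
          have hr0 : δ r = 0 := by
            ext v
            simp [δ, v.2]
          simpa [hr0] using this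
        rw [eq_top_iff, ← (Pi.basisFun ℤ {v : V // v ≠ r}).span_eq, Submodule.span_le]
        rintro _ ⟨v, rfl⟩
        have hv : (Pi.basisFun ℤ {v : V // v ≠ r}) v = δ v.1 := by
          ext u
          simp [δ, Pi.single_apply, Subtype.ext_iff]
        rw [hv]
        exact hmem v.1
      exact LinearMap.range_eq_top.1 hr
    have hu : IsUnit B.det := (Matrix.isUnit_iff_isUnit_det B).1
      (Matrix.vecMul_surjective_iff_isUnit.1 hsurj)
    exact Int.isUnit_sq hu
  · have hconn : ¬ (tgraph G T).Connected := fun h => htree ((tgraph_tree G T).2 ⟨h, by omega⟩)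
    have hex : ∃ v, ¬ (tgraph G T).Reachable v r := by
      by_contra! hall
      have : Nonempty V := ⟨r⟩
      exact hconn ⟨fun a b => (hall a).trans (hall b).symm⟩
    obtain ⟨v0, hv0⟩ := hex
    have hv0r : v0 ≠ r := fun h => hv0 (h ▸ SimpleGraph.Reachable.refl _)
    let w : {v : V // v ≠ r} → ℤ := fun v => if (tgraph G T).Reachable v.1 r then 0 else 1
    have hext : ∀ a, ext0 r w a = if (tgraph G T).Reachable a r then 0 else 1 := by
      intro a
      unfold ext0
      split_ifs with h1 h2 h2
      · simp [w, h2]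
      · simp [w, h2]
      · rfl
      · exact absurd (by simp at h1; rw [h1]) h2
    have : B.det = 0 := by
      rw [← Matrix.exists_mulVec_eq_zero_iff]
      refine ⟨w, fun h => ?_, ?_⟩
      · have := congrFun h ⟨v0, hv0r⟩
        simp [w, hv0] at this
      · funext v
        rw [hBv, Pi.zero_apply]
        rw [incA_edge G r w (g v).1 _ _ (out_adj _).symm, hext, hext]
        have hadj : (tgraph G T).Adj (Quot.out (g v).1.1).1 (Quot.out (g v).1.1).2 := by
          rw [← SimpleGraph.mem_edgeSet, tgraph_edgeSet, out_adj]
          exact ⟨_, (g v).2, rfl⟩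
        have : (tgraph G T).Reachable (Quot.out (g v).1.1).1 r ↔
            (tgraph G T).Reachable (Quot.out (g v).1.1).2 r :=
          ⟨fun h => hadj.symm.reachable.trans h, fun h => hadj.reachable.trans h⟩
        simp only [this]
    rw [this]
    simp

theorem minor_R {V R : Type*} [Fintype V] [CommRing R] (G : SimpleGraph V) (r : V)
    (T : Finset G.edgeSet)
    (hT : T.card = Fintype.card {v : V // v ≠ r}) :
    ((incA G r R * (incA G r R)ᵀ).submatrix (Subtype.val : T → G.edgeSet)
      (Subtype.val : T → G.edgeSet)).det = if (tgraph G T).IsTree then 1 else 0 := by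
  have := congrArg (Int.castRingHom R) (minor_int G r T hT)
  rw [RingHom.map_det] at this
  convert this using 1
  · congr 1
    ext i j
    simp [Matrix.mul_apply, incA]
  · split_ifs <;> simp

theorem graphPoly_eval {V K : Type*} [Fintype V] [Field K] (G : SimpleGraph V) (r : V)
    (x : G.edgeSet → K) :
    (fromBlocks (diagonal x) (incA G r K) (incA G r K)ᵀ 0).det =
      (-1) ^ (Fintype.card {v : V // v ≠ r}) * MvPolynomial.aeval x (graphPoly G) := by
  refine Eq.trans (by congr!) ((bord (incA G r K) x).trans ?_)
  congr 1
  unfold graphPoly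
  rw [map_sum]
  have hV : Fintype.card {v : V // v ≠ r} + 1 = Fintype.card V := by
    have := Fintype.card_pos_iff.2 ⟨r⟩
    rw [Fintype.card_subtype_compl, Fintype.card_subtype_eq]
    omega
  have e1 : ∀ T ∈ (Finset.univ : Finset G.edgeSet).powersetCard (Fintype.card {v : V // v ≠ r}),
      (∏ i ∈ Tᶜ, x i) * ((incA G r K * (incA G r K)ᵀ).submatrix (Subtype.val : T → G.edgeSet)
      (Subtype.val : T → G.edgeSet)).det = if (tgraph G T).IsTree then (∏ i ∈ Tᶜ, x i) else 0 := by
    intro T hT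
    rw [minor_R G r T (Finset.mem_powersetCard.1 hT).2]
    simp
  have e2 : ∑ T ∈ (Finset.univ : Finset G.edgeSet).powersetCard (Fintype.card {v : V // v ≠ r}),
      (if (tgraph G T).IsTree then (∏ i ∈ Tᶜ, x i) else 0) =
      ∑ T : Finset G.edgeSet, (if (tgraph G T).IsTree then (∏ i ∈ Tᶜ, x i) else 0) := by
    apply Finset.sum_subset (Finset.subset_univ _)
    intro T _ hT
    rw [if_neg]
    intro h
    apply hT
    have := ((tgraph_tree G T).1 h).2
    exact Finset.mem_powersetCard.2 ⟨Finset.subset_univ _, by omega⟩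
  refine Eq.trans (by congr!) ((Finset.sum_congr rfl e1).trans ?_)
  rw [e2]
  refine Finset.sum_congr (by congr!) fun T _ => ?_
  split_ifs
  · rw [map_prod]
    simp only [MvPolynomial.aeval_X]
    congr!
  · simp

theorem zero_iff {V K : Type*} [Fintype V] [Field K] (G : SimpleGraph V) (hG : G.Connected) (r : V)
    (x : G.edgeSet → K) :
    MvPolynomial.aeval x (graphPoly G) = 0 ↔
      ∃ y ∈ LinearMap.ker (incA G r K)ᵀ.mulVecLin, y ≠ 0 ∧
        x * y ∈ LinearMap.range (incA G r K).mulVecLin := by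
  have h1 := graphPoly_eval G r x
  have h2 : MvPolynomial.aeval x (graphPoly G) = 0 ↔
      (fromBlocks (diagonal x) (incA G r K) (incA G r K)ᵀ 0).det = 0 := by
    rw [h1]
    simp
  rw [h2, ← Matrix.exists_mulVec_eq_zero_iff]
  constructor
  · rintro ⟨v, hv, h⟩
    rw [fromBlocks_mulVec] at h
    have ha : diagonal x *ᵥ (v ∘ Sum.inl) + incA G r K *ᵥ (v ∘ Sum.inr) = 0 :=
      funext fun i => congrFun h (Sum.inl i)
    have hb : (incA G r K)ᵀ *ᵥ (v ∘ Sum.inl) = 0 := by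
      have : (incA G r K)ᵀ *ᵥ (v ∘ Sum.inl) + 0 *ᵥ (v ∘ Sum.inr) = 0 :=
        funext fun i => congrFun h (Sum.inr i)
      simpa using this
    have hd : diagonal x *ᵥ (v ∘ Sum.inl) = x * (v ∘ Sum.inl) := by
      ext i
      simp [mulVec_diagonal]
    rw [hd] at ha
    refine ⟨v ∘ Sum.inl, hb, ?_, ?_⟩
    · intro h0
      rw [h0, mul_zero, zero_add] at ha
      have := incA_inj G hG r _ ha
      apply hv
      ext (i | i)
      · exact congrFun h0 i
      · exact congrFun this i
    · refine ⟨-(v ∘ Sum.inr), ?_⟩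
      rw [map_neg, mulVecLin_apply]
      exact (eq_neg_of_add_eq_zero_left ha).symm
  · rintro ⟨y, hy, hy0, w, hw⟩
    refine ⟨Sum.elim y (-w), fun h => hy0 ?_, ?_⟩
    · ext i
      exact congrFun h (Sum.inl i)
    · rw [fromBlocks_mulVec]
      have hd : diagonal x *ᵥ y = x * y := by
        ext i
        simp [mulVec_diagonal]
      have hy' : (incA G r K)ᵀ *ᵥ y = 0 := hy
      rw [mulVecLin_apply] at hw
      simp only [Sum.elim_comp_inl, Sum.elim_comp_inr, hd, hy', mulVec_neg, hw]
      ext (i | i) <;> simp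

theorem stmt15 {V : Type*} [Fintype V] (G : SimpleGraph V) (hG : G.Connected)
    (hV : 3 ≤ Fintype.card V) (hE : 5 ≤ Nat.card G.edgeSet)
    (hh : 2 * ((Nat.card G.edgeSet : ℤ) - (Fintype.card V : ℤ) + 1) <
      (Nat.card G.edgeSet : ℤ))
    (K : Type) [Field K] [Fintype K] :
    Xcount G K ≡ 0 [MOD (Fintype.card K) ^ 3] := by
  rw [Nat.modEq_zero_iff_dvd]
  obtain ⟨r⟩ := hG.nonempty
  have hV' : Fintype.card {v : V // v ≠ r} + 1 = Fintype.card V := by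
    rw [Fintype.card_subtype_compl, Fintype.card_subtype_eq]
    omega
  have hfin : Module.finrank K (LinearMap.range (incA G r K).mulVecLin)
      = Fintype.card {v : V // v ≠ r} := by
    rw [LinearMap.finrank_range_of_inj, Module.finrank_fintype_fun_eq_card]
    rw [injective_iff_map_eq_zero]
    intro w hw
    exact incA_inj G hG r w hw
  rw [Nat.card_eq_fintype_card] at hE hh
  have := count_main (LinearMap.ker (incA G r K)ᵀ.mulVecLin)
    (LinearMap.range (incA G r K).mulVecLin) (by
      rintro z hz _ ⟨w, rfl⟩
      have hz' : (incA G r K)ᵀ *ᵥ z = 0 := hz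
      rw [mulVecLin_apply, dotProduct_mulVec, ← mulVec_transpose, hz', zero_dotProduct])
    (by omega) (by omega)
  unfold Xcount
  simpa only [zero_iff G hG r] using this
end

section
/- Let K₄ be the complete graph on 4 vertices. Then for every prime power q, [X_{K₄}]_q ≡ −q² (mod q³); that is, c2(K₄)_q ≡ −1 (mod q). (Since K₄ = K₅∖v, this says c2[K₅]_q ≡ −1 for the completed primitive graph K₅.) -/
open scoped Classical
open Matrix

theorem k4_conn (G : SimpleGraph (Fin 4)) : G.Connected ↔
    ∀ v, ∃ u w, (0 = u ∨ G.Adj 0 u) ∧ (u = w ∨ G.Adj u w) ∧ (w = v ∨ G.Adj w v) := by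
  constructor
  · intro h v
    obtain ⟨p, hp⟩ := (h.preconnected 0 v).exists_isPath
    have hl := hp.length_lt
    simp only [Fintype.card_fin] at hl
    clear hp
    rcases p with _ | ⟨h1, _ | ⟨h2, _ | ⟨h3, _ | ⟨h4, p⟩⟩⟩⟩
    · exact ⟨_, _, Or.inl rfl, Or.inl rfl, Or.inl rfl⟩
    · exact ⟨_, _, Or.inr h1, Or.inl rfl, Or.inl rfl⟩
    · exact ⟨_, _, Or.inr h1, Or.inr h2, Or.inl rfl⟩
    · exact ⟨_, _, Or.inr h1, Or.inr h2, Or.inr h3⟩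
    · simp at hl
      omega
  · intro h
    have aux : ∀ a b, (a = b ∨ G.Adj a b) → G.Reachable a b := by
      rintro a b (rfl | h)
      · exact SimpleGraph.Reachable.refl _
      · exact h.reachable
    have h0 : ∀ v, G.Reachable 0 v := fun v => by
      obtain ⟨u, w, h1, h2, h3⟩ := h v
      exact ((aux _ _ h1).trans (aux _ _ h2)).trans (aux _ _ h3)
    exact ⟨fun a b => (h0 a).symm.trans (h0 b)⟩

def k4g : Fin 6 → Sym2 (Fin 4) := ![s(0,1), s(0,2), s(0,3), s(1,2), s(1,3), s(2,3)]

theorem k4g_mem (i : Fin 6) : k4g i ∈ (⊤ : SimpleGraph (Fin 4)).edgeSet := by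
  fin_cases i <;> simp [k4g]

theorem k4g_inj : Function.Injective k4g := by
  unfold Function.Injective; decide

theorem k4g_surj : ∀ a b : Fin 4, a ≠ b → ∃ i, k4g i = s(a, b) := by decide

noncomputable def k4e : Fin 6 ≃ (⊤ : SimpleGraph (Fin 4)).edgeSet :=
  Equiv.ofBijective (fun i => ⟨k4g i, k4g_mem i⟩) (by
    constructor
    · intro i j h
      exact k4g_inj (congrArg Subtype.val h)
    · rintro ⟨z, hz⟩
      induction z using Sym2.ind with
      | _ a b =>
        obtain ⟨i, hi⟩ := k4g_surj a b (by simpa using hz)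
        exact ⟨i, Subtype.ext hi⟩)

def k4L : Fin 16 → Finset (Fin 6) :=
  ![{0,1,3}, {0,1,4}, {0,1,5}, {0,2,3}, {0,2,4}, {0,2,5}, {0,3,5}, {0,4,5},
    {1,2,3}, {1,2,4}, {1,2,5}, {1,3,4}, {1,4,5}, {2,3,4}, {2,3,5}, {3,4,5}]

theorem k4L_inj : Function.Injective k4L := by
  unfold Function.Injective; decide

def k4adj (S : Finset (Fin 6)) (a b : Fin 4) : Prop := ∃ i, i ∉ S ∧ k4g i = s(a, b)

instance (S : Finset (Fin 6)) (a b : Fin 4) : Decidable (k4adj S a b) := by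
  unfold k4adj; infer_instance

set_option maxRecDepth 100000 in
theorem k4_dec : ∀ S : Finset (Fin 6), ((∀ v : Fin 4, ∃ u w : Fin 4, (0 = u ∨ k4adj S 0 u) ∧
    (u = w ∨ k4adj S u w) ∧ (w = v ∨ k4adj S w v)) ∧ Sᶜ.card + 1 = 4) ↔
    ∃ i, k4L i = S := by
  decide +kernel

theorem k4_tree (S : Finset (Fin 6)) :
    (SimpleGraph.fromEdgeSet (k4g '' ((Sᶜ : Finset (Fin 6)) : Set (Fin 6)))).IsTree ↔
    ∃ i, k4L i = S := by
  rw [← k4_dec, SimpleGraph.isTree_iff_connected_and_card, k4_conn]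
  have hadj : ∀ a b, (SimpleGraph.fromEdgeSet
      (k4g '' ((Sᶜ : Finset (Fin 6)) : Set (Fin 6)))).Adj a b ↔ k4adj S a b := by
    intro a b
    simp only [SimpleGraph.fromEdgeSet_adj, k4adj, Set.mem_image, Finset.coe_compl,
      Set.mem_compl_iff, Finset.mem_coe]
    constructor
    · exact fun h => h.1
    · rintro ⟨i, hi, h⟩
      refine ⟨⟨i, hi, h⟩, ?_⟩
      have := k4g_mem i
      rw [h] at this
      simpa using this
  have hcard : Nat.card (SimpleGraph.fromEdgeSet
      (k4g '' ((Sᶜ : Finset (Fin 6)) : Set (Fin 6)))).edgeSet = Sᶜ.card := by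
    rw [SimpleGraph.edgeSet_fromEdgeSet, sdiff_eq_left.mpr]
    · rw [Nat.card_coe_set_eq, Set.ncard_image_of_injective _ k4g_inj, Set.ncard_coe_finset]
    · rw [Set.disjoint_left]
      rintro _ ⟨i, _, rfl⟩ h
      have := k4g_mem i
      exact SimpleGraph.not_isDiag_of_mem_edgeSet _ this h
  simp only [hadj, hcard, Nat.card_fin]

theorem k4_eval {K : Type} [Field K] (x : (⊤ : SimpleGraph (Fin 4)).edgeSet → K) :
    MvPolynomial.aeval x (graphPoly (⊤ : SimpleGraph (Fin 4))) =
      ∑ i, ∏ j ∈ k4L i, x (k4e j) := by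
  unfold graphPoly
  let _ : Fintype (⊤ : SimpleGraph (Fin 4)).edgeSet := Fintype.ofFinite _
  have key : ∀ S : Finset (Fin 6),
      (SimpleGraph.fromEdgeSet (Subtype.val ''
        (((S.map k4e.toEmbedding)ᶜ : Finset (⊤ : SimpleGraph (Fin 4)).edgeSet) :
          Set (⊤ : SimpleGraph (Fin 4)).edgeSet))).IsTree ↔ ∃ i, k4L i = S := by
    intro S
    rw [← k4_tree]
    have : (Subtype.val '' (((S.map k4e.toEmbedding)ᶜ :
          Finset (⊤ : SimpleGraph (Fin 4)).edgeSet) :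
          Set (⊤ : SimpleGraph (Fin 4)).edgeSet)) =
        k4g '' ((Sᶜ : Finset (Fin 6)) : Set (Fin 6)) := by
      ext z
      constructor
      · rintro ⟨y, hy, rfl⟩
        obtain ⟨i, rfl⟩ := k4e.surjective y
        refine ⟨i, ?_, rfl⟩
        simpa using hy
      · rintro ⟨i, hi, rfl⟩
        refine ⟨k4e i, ?_, rfl⟩
        simpa using hi
    rw [this]
  rw [map_sum]
  rw [← Equiv.sum_comp ((Equiv.finsetCongr k4e).trans (Equiv.ofBijective _ compl_bijective))]
  simp only [Equiv.trans_apply, Equiv.ofBijective_apply, Equiv.finsetCongr_apply]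
  simp only [key, apply_ite, map_zero, map_prod, MvPolynomial.aeval_X]
  rw [← Finset.sum_filter]
  have : (Finset.univ.filter fun S : Finset (Fin 6) => ∃ i, k4L i = S) =
      Finset.univ.map ⟨k4L, k4L_inj⟩ := by
    ext S; simp
  rw [this, Finset.sum_map]
  refine Finset.sum_congr rfl fun i _ => ?_
  refine Eq.trans ?_ (Finset.prod_map (k4L i) k4e.toEmbedding x)
  refine Finset.prod_congr ?_ fun _ _ => rfl
  ext z
  simp

theorem k4_explicit {K : Type} [Field K] (y : Fin 6 → K) :
    ∑ i, ∏ j ∈ k4L i, y j =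
     (y 0 + y 1 + y 3) * (y 0 + y 2 + y 4) * (y 1 + y 2 + y 5) - 2 * y 0 * y 1 * y 2
     - (y 0 + y 1 + y 3) * y 2 ^ 2 - (y 0 + y 2 + y 4) * y 1 ^ 2
     - (y 1 + y 2 + y 5) * y 0 ^ 2 := by
  simp [Fin.sum_univ_succ, k4L]
  ring

/-- variables: t = (A, e, f), y = (B, C, d) -/
def k4Q {K : Type} [Field K] (t y : K × K × K) : K :=
  t.1 * y.1 * y.2.1 - 2 * t.2.2 * t.2.1 * y.2.2
     - t.1 * y.2.2 ^ 2 - y.1 * t.2.1 ^ 2 - y.2.1 * t.2.2 ^ 2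

noncomputable def k4big {K : Type} [Field K] :
    {x : (⊤ : SimpleGraph (Fin 4)).edgeSet → K //
      MvPolynomial.aeval x (graphPoly (⊤ : SimpleGraph (Fin 4))) = 0} ≃
    Σ t : K × K × K, {y : K × K × K // k4Q t y = 0} where
  toFun x := ⟨(x.1 (k4e 0) + x.1 (k4e 1) + x.1 (k4e 3), x.1 (k4e 1), x.1 (k4e 0)),
    ⟨(x.1 (k4e 0) + x.1 (k4e 2) + x.1 (k4e 4), x.1 (k4e 1) + x.1 (k4e 2) + x.1 (k4e 5),
      x.1 (k4e 2)), by
      have := x.2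
      rw [k4_eval, k4_explicit (fun j => x.1 (k4e j))] at this
      exact this⟩⟩
  invFun p := ⟨fun z => (![p.1.2.2, p.1.2.1, p.2.1.2.2, p.1.1 - p.1.2.2 - p.1.2.1,
      p.2.1.1 - p.1.2.2 - p.2.1.2.2, p.2.1.2.1 - p.1.2.1 - p.2.1.2.2] : Fin 6 → K) (k4e.symm z), by
      rw [k4_eval, k4_explicit]
      have := p.2.2
      simp [k4Q] at this ⊢
      linear_combination this⟩
  left_inv x := by
    ext z
    obtain ⟨i, rfl⟩ := k4e.surjective z
    fin_cases i <;> simp <;> ring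
  right_inv p := by
    obtain ⟨⟨A, e, f⟩, ⟨⟨B, C, d⟩, h⟩⟩ := p
    have : ∀ t t' : K × K × K, ∀ y y' (h : k4Q t y = 0) (h' : k4Q t' y' = 0), t = t' → y = y' →
      (⟨t, ⟨y, h⟩⟩ : Σ t : K × K × K, {y : K × K × K // k4Q t y = 0}) = ⟨t', ⟨y', h'⟩⟩ := by
      rintro t _ y _ _ _ rfl rfl; rfl
    apply this <;> simp

noncomputable def k4cone {K : Type} [Field K] :
    {y : K × K × K // y.1 * y.2.1 = y.2.2 ^ 2} ≃ K × K where
  toFun y := (y.1.1, if y.1.1 = 0 then y.1.2.1 else y.1.2.2)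
  invFun p := if h : p.1 = 0 then ⟨(0, p.2, 0), by simp⟩ else
    ⟨(p.1, p.2 ^ 2 / p.1, p.2), by field_simp⟩
  left_inv := by
    rintro ⟨⟨B, C, d⟩, h⟩
    by_cases hB : B = 0
    · subst hB
      have : d = 0 := by simpa using h.symm
      subst this
      simp
    · simp only at h
      simp only [hB, dite_false, if_false]
      refine Subtype.ext (Prod.ext rfl (Prod.ext ?_ rfl))
      simp only
      field_simp
      exact h.symm
  right_inv := by
    rintro ⟨a, b⟩
    by_cases h : a = 0 <;> simp [h]

noncomputable def k4A {K : Type} [Field K] (A e f : K) (hA : A ≠ 0) :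
    {y : K × K × K // k4Q (A, e, f) y = 0} ≃
    {y : K × K × K // y.1 * y.2.1 = y.2.2 ^ 2} where
  toFun y := ⟨(A * y.1.1 - f ^ 2, A * y.1.2.1 - e ^ 2, A * y.1.2.2 + e * f), by
    have := y.2
    simp only [k4Q] at this ⊢
    linear_combination A * this⟩
  invFun y := ⟨((y.1.1 + f ^ 2) / A, (y.1.2.1 + e ^ 2) / A, (y.1.2.2 - e * f) / A), by
    have := y.2
    simp only [k4Q] at this ⊢
    field_simp
    linear_combination this⟩
  left_inv := by
    rintro ⟨⟨B, C, d⟩, h⟩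
    simp [hA]
  right_inv := by
    rintro ⟨⟨B, C, d⟩, h⟩
    simp [mul_div_cancel₀, hA]

noncomputable def k4E {K : Type} [Field K] (e f : K) (he : e ≠ 0) :
    {y : K × K × K // k4Q (0, e, f) y = 0} ≃ K × K where
  toFun y := (y.1.2.1, y.1.2.2)
  invFun p := ⟨((- 2 * f * e * p.2 - p.1 * f ^ 2) / e ^ 2, p.1, p.2), by
    simp only [k4Q]
    field_simp
    ring⟩
  left_inv := by
    rintro ⟨⟨B, C, d⟩, h⟩
    simp only [k4Q] at h
    refine Subtype.ext (Prod.ext ?_ rfl)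
    simp only
    field_simp
    linear_combination h
  right_inv _ := rfl

noncomputable def k4F {K : Type} [Field K] (f : K) (hf : f ≠ 0) :
    {y : K × K × K // k4Q (0, 0, f) y = 0} ≃ K × K where
  toFun y := (y.1.1, y.1.2.2)
  invFun p := ⟨(p.1, 0, p.2), by simp [k4Q]⟩
  left_inv := by
    rintro ⟨⟨B, C, d⟩, h⟩
    simp [k4Q, hf] at h
    subst h
    rfl
  right_inv _ := rfl

theorem k4_fiber {K : Type} [Field K] [Fintype K] (t : K × K × K) :
    Nat.card {y : K × K × K // k4Q t y = 0} =
      if t = 0 then Fintype.card K ^ 3 else Fintype.card K ^ 2 := by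
  obtain ⟨A, e, f⟩ := t
  have hp : Nat.card (K × K) = Fintype.card K ^ 2 := by
    rw [Nat.card_prod, Nat.card_eq_fintype_card, sq]
  by_cases hA : A = 0
  · subst hA
    by_cases he : e = 0
    · subst he
      by_cases hf : f = 0
      · subst hf
        simp [k4Q]
        ring
      · rw [Nat.card_congr (k4F f hf), hp]
        simp [hf]
    · rw [Nat.card_congr (k4E e f he), hp]
      simp [he]
  · rw [Nat.card_congr ((k4A A e f hA).trans k4cone), hp]
    simp [hA]

theorem stmt16 (K : Type) [Field K] [Fintype K] :
    (Xcount (⊤ : SimpleGraph (Fin 4)) K : ℤ) ≡ -(Fintype.card K : ℤ) ^ 2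
      [ZMOD ((Fintype.card K : ℤ)) ^ 3] := by
  have h : (Xcount (⊤ : SimpleGraph (Fin 4)) K : ℤ) =
      (Fintype.card K : ℤ) ^ 5 + (Fintype.card K : ℤ) ^ 3 - (Fintype.card K : ℤ) ^ 2 := by
    unfold Xcount
    rw [Nat.card_congr k4big, Nat.card_sigma]
    simp only [k4_fiber]
    push_cast
    have : ∀ t : K × K × K, (if t = 0 then (Fintype.card K : ℤ) ^ 3 else (Fintype.card K : ℤ) ^ 2)
        = (if t = 0 then (Fintype.card K : ℤ) ^ 3 - (Fintype.card K : ℤ) ^ 2 else 0)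
          + (Fintype.card K : ℤ) ^ 2 := by
      intro t; split_ifs <;> ring
    simp only [this, Finset.sum_add_distrib, Finset.sum_ite_eq', Finset.sum_const]
    simp
    ring
  rw [h]
  apply Int.ModEq.symm
  rw [Int.modEq_iff_dvd]
  exact ⟨(Fintype.card K : ℤ) ^ 2 + 1, by ring⟩
end

section
/- Let G be a primitive-divergent graph in φ⁴ theory with at least 5 vertices in which exactly four vertices have degree 3 and all other vertices have degree 4. Let Γ be the completion of G, obtained by adding one new vertex joined by a single edge to each of the four degree-3 vertices of G. Then Γ is a completed primitive graph. -/
open scoped Classical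
open Matrix

/-- The first Betti number of the subgraph spanned by an edge set `S`
(isolated vertices of `fromEdgeSet S` cancel in `|S| - |V| + #components`). -/
noncomputable def edgeBetti {V : Type*} [Fintype V] (S : Set (Sym2 V)) : ℤ :=
  (Nat.card S : ℤ) - (Fintype.card V : ℤ) +
    (Nat.card (SimpleGraph.fromEdgeSet S).ConnectedComponent : ℤ)

/-- A connected graph is primitive-divergent if `N_G = 2 h_G` and every subgraph spanned
by a proper non-empty subset of the edges satisfies `N_γ > 2 h_γ`. -/
def IsPrimitiveDivergent {V : Type*} [Fintype V] (G : SimpleGraph V) : Prop :=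
  G.Connected ∧
  (Nat.card G.edgeSet : ℤ) = 2 * ((Nat.card G.edgeSet : ℤ) - (Fintype.card V : ℤ) + 1) ∧
  ∀ S : Set (Sym2 V), S ⊆ G.edgeSet → S.Nonempty → S ≠ G.edgeSet →
    2 * edgeBetti S < (Nat.card S : ℤ)

/-- A graph is in φ⁴ theory if every vertex has degree at most 4. -/
def InPhi4 {V : Type*} (G : SimpleGraph V) : Prop :=
  ∀ v : V, Nat.card (G.neighborSet v) ≤ 4

/-- A connected 4-regular simple graph with at least 5 vertices is completed primitive if
removing any 4 edges leaves it either connected or with an isolated vertex. -/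
def IsCompletedPrimitive {W : Type*} [Fintype W] (Γ : SimpleGraph W) : Prop :=
  Γ.Connected ∧ (∀ w : W, Nat.card (Γ.neighborSet w) = 4) ∧ 5 ≤ Fintype.card W ∧
  ∀ C : Set (Sym2 W), C ⊆ Γ.edgeSet → Nat.card C = 4 →
    (Γ.deleteEdges C).Connected ∨ ∃ w : W, ∀ u : W, ¬ (Γ.deleteEdges C).Adj w u

/-- The completion of a primitive-divergent φ⁴ graph whose 3-valent vertices all get
joined to one new vertex. -/
def completionGraph {V : Type*} [Fintype V] (G : SimpleGraph V) : SimpleGraph (Option V) :=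
  SimpleGraph.fromRel fun p q =>
    match p, q with
    | some u, some v => G.Adj u v
    | none, some v => Nat.card (G.neighborSet v) = 3
    | some _, none => False
    | none, none => False

theorem aux_adj_some {V : Type*} [Fintype V] (G : SimpleGraph V) (u v : V) :
    (completionGraph G).Adj (some u) (some v) ↔ G.Adj u v := by
  simp only [completionGraph, SimpleGraph.fromRel_adj]
  constructor
  · rintro ⟨_, h | h⟩
    · exact h
    · exact h.symm
  · intro h
    exact ⟨by simpa using h.ne, Or.inl h⟩

theorem aux_adj_none {V : Type*} [Fintype V] (G : SimpleGraph V) (v : V) :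
    (completionGraph G).Adj none (some v) ↔ Nat.card (G.neighborSet v) = 3 := by
  simp only [completionGraph, SimpleGraph.fromRel_adj]
  constructor
  · rintro ⟨_, h | h⟩
    · exact h
    · exact h.elim
  · intro h
    exact ⟨by simp, Or.inl h⟩

theorem aux_reg {V : Type*} [Fintype V] (G : SimpleGraph V)
    (hdeg : ∀ v : V, Nat.card (G.neighborSet v) = 3 ∨ Nat.card (G.neighborSet v) = 4)
    (h4 : Nat.card {v : V // Nat.card (G.neighborSet v) = 3} = 4) (w : Option V) :
    Nat.card ((completionGraph G).neighborSet w) = 4 := by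
  cases w with
  | none =>
    have : (completionGraph G).neighborSet none = some '' {v : V | Nat.card (G.neighborSet v) = 3} := by
      ext x
      cases x with
      | none => simp
      | some v => simp [aux_adj_none]
    rw [this, Nat.card_image_of_injective (Option.some_injective V)]
    exact h4
  | some v =>
    rcases hdeg v with h | h
    · have : (completionGraph G).neighborSet (some v) = insert none (some '' (G.neighborSet v)) := by
        ext x
        cases x with
        | none => simpa [SimpleGraph.adj_comm, aux_adj_none] using h
        | some v => simp [aux_adj_some]
      rw [this, Nat.card_coe_set_eq, Set.ncard_insert_of_notMem (by simp),
        Set.ncard_image_of_injective _ (Option.some_injective V), ← Nat.card_coe_set_eq, h]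
    · have : (completionGraph G).neighborSet (some v) = (some '' (G.neighborSet v)) := by
        ext x
        cases x with
        | none =>
          have h2 : ¬ (completionGraph G).Adj none (some v) := by
            rw [aux_adj_none]; omega
          simpa [SimpleGraph.adj_comm] using h2
        | some v => simp [aux_adj_some]
      rw [this, Nat.card_image_of_injective (Option.some_injective V), h]

theorem aux_conn {V : Type*} [Fintype V] (G : SimpleGraph V) (hG : G.Connected)
    (h4 : Nat.card {v : V // Nat.card (G.neighborSet v) = 3} = 4) :
    (completionGraph G).Connected := by
  have hne : Nonempty {v : V // Nat.card (G.neighborSet v) = 3} := by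
    by_contra h
    rw [not_nonempty_iff] at h
    rw [Nat.card_of_isEmpty] at h4
    omega
  obtain ⟨⟨v, hv⟩⟩ := hne
  let f : G →g completionGraph G := ⟨some, fun {a b} h => (aux_adj_some G a b).2 h⟩
  rw [SimpleGraph.connected_iff_exists_forall_reachable]
  refine ⟨some v, fun w => ?_⟩
  cases w with
  | none => exact ((aux_adj_none G v).2 hv).symm.reachable
  | some u => exact (hG.preconnected v u).map f

/-- the part of `G` inside `A` -/
def inPart {V : Type*} (G : SimpleGraph V) (A : Set V) : SimpleGraph V where
  Adj u v := G.Adj u v ∧ u ∈ A ∧ v ∈ A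
  symm := ⟨fun _ _ h => ⟨h.1.symm, h.2.2, h.2.1⟩⟩
  loopless := ⟨fun _ h => h.1.ne rfl⟩

theorem aux_count {V : Type*} [Fintype V] (G : SimpleGraph V) (A : Set V)
    (hreg : ∀ w : Option V, Nat.card ((completionGraph G).neighborSet w) = 4)
    (C : Set (Sym2 (Option V))) (hC : Nat.card C = 4)
    (hcut : ∀ v ∈ A, ∀ w : Option V, w ∉ some '' A → (completionGraph G).Adj (some v) w →
      s(some v, w) ∈ C) :
    4 * Nat.card A ≤ 2 * Nat.card (inPart G A).edgeSet + 4 := by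
  set H := inPart G A with hH
  have hsum := H.sum_degrees_eq_twice_card_edges
  have h1 : ∑ v, H.degree v = ∑ v ∈ A.toFinset, H.degree v := by
    symm
    apply Finset.sum_subset (Finset.subset_univ _)
    intro v _ hv
    rw [Set.mem_toFinset] at hv
    rw [← SimpleGraph.card_neighborFinset_eq_degree, Finset.card_eq_zero]
    ext x
    simp only [SimpleGraph.mem_neighborFinset, Finset.notMem_empty, iff_false]
    exact fun h => hv h.2.1
  let out : V → Finset (Option V) := fun v =>
    Finset.univ.filter fun w => w ∉ some '' A ∧ (completionGraph G).Adj (some v) w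
  have h2 : ∀ v ∈ A.toFinset, 4 = H.degree v + (out v).card := by
    intro v hv
    rw [Set.mem_toFinset] at hv
    rw [← hreg (some v), Nat.card_eq_fintype_card, SimpleGraph.card_neighborSet_eq_degree,
      ← SimpleGraph.card_neighborFinset_eq_degree, ← SimpleGraph.card_neighborFinset_eq_degree,
      ← Finset.card_image_of_injective _ (Option.some_injective V),
      ← Finset.card_union_of_disjoint]
    · congr 1
      ext x
      cases x with
      | none => simp [out]
      | some u =>
        simp only [SimpleGraph.mem_neighborFinset, aux_adj_some, Finset.mem_union, Finset.mem_image,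
          out, Finset.mem_filter, Finset.mem_univ, true_and, Set.mem_image, Option.some.injEq,
          exists_eq_right]
        change _ ↔ (G.Adj v u ∧ v ∈ A ∧ u ∈ A) ∨ _
        tauto
    · rw [Finset.disjoint_left]
      intro x hx hx2
      simp only [Finset.mem_image, SimpleGraph.mem_neighborFinset] at hx
      obtain ⟨u, hu, rfl⟩ := hx
      simp only [out, Finset.mem_filter] at hx2
      exact hx2.2.1 ⟨u, hu.2.2, rfl⟩
  have h3 : ∑ v ∈ A.toFinset, (out v).card ≤ 4 := by
    rw [← Finset.card_sigma, ← hC, Nat.card_eq_card_toFinset]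
    apply Finset.card_le_card_of_injOn (fun p => s(some p.1, p.2))
    · rintro ⟨v, w⟩ hp
      simp only [Finset.mem_coe, Finset.mem_sigma, Set.mem_toFinset, out, Finset.mem_filter] at hp
      simpa using hcut v hp.1 w hp.2.2.1 hp.2.2.2
    · rintro ⟨v, w⟩ hp ⟨v', w'⟩ hp' heq
      simp only [Finset.mem_coe, Finset.mem_sigma, Set.mem_toFinset, out, Finset.mem_filter] at hp hp'
      simp only [Sym2.eq_iff] at heq
      rcases heq with ⟨h, h'⟩ | ⟨h, h'⟩
      · cases h; cases h'; rfl
      · exact absurd ⟨v, hp.1, h⟩ hp'.2.2.1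
  have h4 : ∑ v ∈ A.toFinset, 4 = ∑ v ∈ A.toFinset, (H.degree v + (out v).card) :=
    Finset.sum_congr rfl h2
  rw [Finset.sum_add_distrib, Finset.sum_const, ← h1, hsum, smul_eq_mul,
    ← Nat.card_eq_card_toFinset] at h4
  have h5 : H.edgeFinset.card = Nat.card H.edgeSet := by
    rw [Nat.card_eq_fintype_card, SimpleGraph.edgeFinset_card]
  omega

theorem aux_comp {V : Type*} [Fintype V] (G : SimpleGraph V) (A : Set V) (hA : A.Nonempty) :
    Fintype.card V + 1 ≤ Nat.card (inPart G A).ConnectedComponent + Nat.card A := by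
  obtain ⟨a, ha⟩ := hA
  have hr : ∀ u v, (inPart G A).Reachable u v → u ∉ A → u = v := by
    rintro u v ⟨p⟩ hu
    cases p with
    | nil => rfl
    | cons h _ => exact absurd h.2.1 hu
  let f : Option (Aᶜ : Set V) → (inPart G A).ConnectedComponent := fun o =>
    match o with
    | none => (inPart G A).connectedComponentMk a
    | some x => (inPart G A).connectedComponentMk x.1
  have hf : Function.Injective f := by
    rintro (_ | ⟨x, hx⟩) (_ | ⟨y, hy⟩) h
    · rfl
    · exact absurd ha (hr _ _ (SimpleGraph.ConnectedComponent.exact h).symm hy ▸ hy)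
    · exact absurd ha (hr _ _ (SimpleGraph.ConnectedComponent.exact h) hx ▸ hx)
    · have := hr _ _ (SimpleGraph.ConnectedComponent.exact h) hx
      cases this; rfl
  have h1 := Nat.card_le_card_of_injective f hf
  rw [Finite.card_option, Nat.card_coe_set_eq] at h1
  have h2 := Set.ncard_add_ncard_compl A
  rw [Nat.card_eq_fintype_card] at h2
  rw [Nat.card_coe_set_eq A]
  omega

theorem stmt17 {V : Type*} [Fintype V] (G : SimpleGraph V)
    (hpd : IsPrimitiveDivergent G) (hphi4 : InPhi4 G) (hV : 5 ≤ Fintype.card V)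
    (hdeg : ∀ v : V, Nat.card (G.neighborSet v) = 3 ∨ Nat.card (G.neighborSet v) = 4)
    (h4 : Nat.card {v : V // Nat.card (G.neighborSet v) = 3} = 4) :
    IsCompletedPrimitive (completionGraph G) := by
  have hreg := aux_reg G hdeg h4
  refine ⟨aux_conn G hpd.1 h4, hreg, by rw [Fintype.card_option]; omega, ?_⟩
  intro C hCsub hC
  by_contra! hcon
  obtain ⟨hnc, hiso⟩ := hcon
  set D := (completionGraph G).deleteEdges C with hD
  let A : Set V := {v | ¬ D.Reachable none (some v)}
  have hAne : A.Nonempty := by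
    by_contra hA
    apply hnc
    rw [SimpleGraph.connected_iff_exists_forall_reachable]
    refine ⟨none, fun w => ?_⟩
    cases w with
    | none => rfl
    | some v =>
      by_contra hv
      exact hA ⟨v, hv⟩
  have hclosed : ∀ v ∈ A, ∀ w, D.Adj (some v) w → w ∈ some '' A := by
    intro v hv w hw
    cases w with
    | none => exact absurd hw.symm.reachable hv
    | some u => exact ⟨u, fun hu => hv (hu.trans hw.symm.reachable), rfl⟩
  have hcount := aux_count G A hreg C hC (by
    intro v hv w hw hadj
    by_contra hn
    exact hw (hclosed v hv w (by rw [hD, SimpleGraph.deleteEdges_adj]; exact ⟨hadj, hn⟩)))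
  have hcomp := aux_comp G A hAne
  have hA2 : 2 ≤ Nat.card A := by
    by_contra hlt
    obtain ⟨v, hv⟩ := hAne
    obtain ⟨u, hu⟩ := hiso (some v)
    obtain ⟨u', hu', rfl⟩ := hclosed v hv u hu
    have hss : Subsingleton A := Finite.card_le_one_iff_subsingleton.1 (by omega)
    have : (⟨v, hv⟩ : A) = ⟨u', hu'⟩ := Subsingleton.elim _ _
    have h' : v = u' := congrArg Subtype.val this
    exact hu.ne (congrArg some h')
  have hS := hpd.2.2 (inPart G A).edgeSet
    (SimpleGraph.edgeSet_mono (fun _ _ h => h.1))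
    (by
      by_contra hne
      rw [Set.not_nonempty_iff_eq_empty] at hne
      rw [hne] at hcount
      simp at hcount
      simp at hA2
      omega)
    (by
      intro heq
      have heq' : inPart G A = G := SimpleGraph.edgeSet_injective heq
      obtain ⟨u, hu⟩ := hiso none
      cases u with
      | none => exact hu.ne rfl
      | some v =>
        have hne : Nonempty (G.neighborSet v) := by
          by_contra h
          rw [not_nonempty_iff] at h
          have := hdeg v
          simp at this
        obtain ⟨x, hx⟩ := hne
        have hx' : (inPart G A).Adj v x := heq'.symm ▸ hx
        exact hx'.2.1 hu.reachable)
  unfold edgeBetti at hS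
  rw [SimpleGraph.fromEdgeSet_edgeSet] at hS
  omega
end

section
/- Let Γ be a connected 4-regular simple graph with at least 6 vertices having a double-triangle configuration (a,b,c,d,x), and let Γ′ be its double-triangle reduction at this configuration. Then Γ′ is completed primitive if and only if Γ is completed primitive. -/
open scoped Classical
open Matrix

/-- A double-triangle configuration `(a,b,c,d,x)` in `Γ`. -/
def DTConfig {W : Type*} (Γ : SimpleGraph W) (a b c d x : W) : Prop :=
  Γ.Adj a b ∧ Γ.Adj a c ∧ Γ.Adj b c ∧ Γ.Adj a d ∧ Γ.Adj b d ∧ c ≠ d ∧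
  (∀ y : W, Γ.Adj a y → Γ.Adj b y → y = c ∨ y = d) ∧
  Γ.Adj b x ∧ x ≠ a ∧ x ≠ c ∧ x ≠ d ∧ ¬ Γ.Adj c d ∧ ¬ Γ.Adj a x

/-- The double-triangle reduction of `Γ` at the configuration `(a,b,c,d,x)`:
delete the vertex `b` and add the edges `cd` and `ax`. -/
def dtReduced {W : Type*} (Γ : SimpleGraph W) (a b c d x : W) :
    SimpleGraph {u : W // u ≠ b} :=
  SimpleGraph.fromRel fun u v =>
    Γ.Adj ↑u ↑v ∨ ((u : W) = c ∧ (v : W) = d) ∨ ((u : W) = a ∧ (v : W) = x)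

/-- integer adjacency matrix -/
noncomputable def adjM {W : Type*} (G : SimpleGraph W) (u v : W) : ℤ := if G.Adj u v then 1 else 0

/-- quadratic cut functional -/
noncomputable def cutQ {W : Type*} [Fintype W] (A : W → W → ℤ) (s : W → ℤ) : ℤ :=
  ∑ u, ∑ v, A u v * (s u * (1 - s v))

/-- indicator -/
noncomputable def indS {W : Type*} (S : Finset W) (u : W) : ℤ := if u ∈ S then 1 else 0

/-- all nontrivial cuts have more than four edges -/
def BigCuts {W : Type*} [Fintype W] (G : SimpleGraph W) : Prop :=
  ∀ S : Finset W, 2 ≤ S.card → S.card + 2 ≤ Fintype.card W → 4 < cutQ (adjM G) (indS S)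

lemma cutQ_compl {W : Type*} [Fintype W] (G : SimpleGraph W) (s : W → ℤ) :
    cutQ (adjM G) (fun u => 1 - s u) = cutQ (adjM G) s := by
  unfold cutQ
  rw [Finset.sum_comm]
  refine Finset.sum_congr rfl fun u _ => Finset.sum_congr rfl fun v _ => ?_
  simp only [adjM, G.adj_comm u v]
  ring

lemma indS_compl {W : Type*} [Fintype W] (S : Finset W) :
    indS Sᶜ = fun u => 1 - indS S u := by
  funext u
  by_cases h : u ∈ S <;> simp [indS, h]

lemma cutQ_indS_compl {W : Type*} [Fintype W] (G : SimpleGraph W) (S : Finset W) :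
    cutQ (adjM G) (indS Sᶜ) = cutQ (adjM G) (indS S) := by
  rw [indS_compl, cutQ_compl]

lemma exists_compl {W : Type*} [Fintype W] (G : SimpleGraph W) (S : Finset W) :
    ∃ U : Finset W, (∀ u, u ∈ U ↔ u ∉ S) ∧ S.card + U.card = Fintype.card W ∧
      cutQ (adjM G) (indS U) = cutQ (adjM G) (indS S) :=
  ⟨Sᶜ, fun u => by simp, Finset.card_add_card_compl S, cutQ_indS_compl G S⟩

/-- cut pairs -/
noncomputable def cutPairs {W : Type*} [Fintype W] (G : SimpleGraph W) (S : Finset W) :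
    Finset (W × W) := Finset.univ.filter (fun p => G.Adj p.1 p.2 ∧ p.1 ∈ S ∧ p.2 ∉ S)

lemma cutQ_card {W : Type*} [Fintype W] (G : SimpleGraph W) (S : Finset W) :
    cutQ (adjM G) (indS S) = ((cutPairs G S).card : ℤ) := by
  unfold cutQ cutPairs
  rw [Finset.card_filter, ← Finset.univ_product_univ, Finset.sum_product]
  push_cast
  refine Finset.sum_congr rfl fun u _ => Finset.sum_congr rfl fun v _ => ?_
  simp only [adjM, indS]
  by_cases h1 : G.Adj u v <;> by_cases h2 : u ∈ S <;> by_cases h3 : v ∈ S <;> simp [h1, h2, h3]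

/-- cut edges -/
noncomputable def cutEdges {W : Type*} [Fintype W] (G : SimpleGraph W) (S : Finset W) :
    Finset (Sym2 W) := (cutPairs G S).image (fun p => s(p.1, p.2))

lemma mem_cutEdges {W : Type*} [Fintype W] (G : SimpleGraph W) (S : Finset W) (u v : W) :
    s(u, v) ∈ cutEdges G S ↔ G.Adj u v ∧ ((u ∈ S ∧ v ∉ S) ∨ (v ∈ S ∧ u ∉ S)) := by
  simp only [cutEdges, cutPairs, Finset.mem_image, Finset.mem_filter, Finset.mem_univ, true_and,
    Prod.exists, Sym2.eq_iff]
  constructor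
  · rintro ⟨p, q, ⟨h1, h2, h3⟩, ⟨rfl, rfl⟩ | ⟨rfl, rfl⟩⟩
    · exact ⟨h1, Or.inl ⟨h2, h3⟩⟩
    · exact ⟨h1.symm, Or.inr ⟨h2, h3⟩⟩
  · rintro ⟨h, ⟨h2, h3⟩ | ⟨h2, h3⟩⟩
    · exact ⟨u, v, ⟨h, h2, h3⟩, Or.inl ⟨rfl, rfl⟩⟩
    · exact ⟨v, u, ⟨h.symm, h2, h3⟩, Or.inr ⟨rfl, rfl⟩⟩

lemma cutEdges_card {W : Type*} [Fintype W] (G : SimpleGraph W) (S : Finset W) :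
    cutQ (adjM G) (indS S) = ((cutEdges G S).card : ℤ) := by
  rw [cutQ_card, cutEdges, Finset.card_image_of_injOn]
  rintro ⟨p, q⟩ h ⟨p', q'⟩ h' e
  simp only [cutPairs, Finset.coe_filter, Finset.mem_univ, true_and, Set.mem_ofPred_eq] at h h'
  simp only [Sym2.eq_iff] at e
  rcases e with ⟨rfl, rfl⟩ | ⟨rfl, rfl⟩
  · rfl
  · exact absurd h.2.1 h'.2.2

lemma cutEdges_compl {W : Type*} [Fintype W] (G : SimpleGraph W) (S : Finset W) :
    cutEdges G Sᶜ = cutEdges G S := by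
  ext e
  induction e with
  | _ u v =>
    rw [mem_cutEdges, mem_cutEdges]
    simp only [Finset.mem_compl]
    tauto

lemma exists_cross {W : Type*} [Fintype W] {G : SimpleGraph W} (h : G.Connected) (S : Finset W)
    {p q : W} (hp : p ∈ S) (hq : q ∉ S) : ∃ u v, G.Adj u v ∧ u ∈ S ∧ v ∉ S := by
  obtain ⟨w⟩ := h.preconnected p q
  obtain ⟨d, _, h1, h2⟩ := w.exists_boundary_dart (S : Set W) (by simpa using hp) (by simpa using hq)
  exact ⟨d.fst, d.snd, d.adj, by simpa using h1, by simpa using h2⟩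

lemma exists_sep {W : Type*} [Fintype W] [Nonempty W] {G : SimpleGraph W} (h : ¬ G.Connected) :
    ∃ (S : Finset W) (p q : W), p ∈ S ∧ q ∉ S ∧ ∀ u v, u ∈ S → v ∉ S → ¬ G.Adj u v := by
  have : ¬ G.Preconnected := fun h' => h ⟨h'⟩
  unfold SimpleGraph.Preconnected at this
  push Not at this
  obtain ⟨p, q, hpq⟩ := this
  refine ⟨Finset.univ.filter (fun u => G.Reachable p u), p, q, by simp, by simpa using hpq, ?_⟩
  intro u v hu hv ha
  simp only [Finset.mem_filter, Finset.mem_univ, true_and] at hu hv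
  exact hv (hu.trans ha.reachable)

lemma sum_adjM {W : Type*} [Fintype W] {G : SimpleGraph W} (u : W) :
    ∑ v, adjM G u v = (Nat.card (G.neighborSet u) : ℤ) := by
  rw [Nat.card_eq_fintype_card, SimpleGraph.card_neighborSet_eq_degree]
  unfold adjM
  rw [Finset.sum_boole, ← SimpleGraph.card_neighborFinset_eq_degree]
  congr 2
  ext v; simp

lemma cut_small1 {W : Type*} [Fintype W] {G : SimpleGraph W}
    (hreg : ∀ w : W, Nat.card (G.neighborSet w) = 4) (w : W) :
    cutQ (adjM G) (indS {w}) = 4 := by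
  unfold cutQ
  rw [Finset.sum_eq_single w]
  · have h4 : ∑ v, adjM G w v = 4 := by rw [sum_adjM, hreg]; rfl
    rw [← h4]
    refine Finset.sum_congr rfl fun v _ => ?_
    by_cases h : v = w
    · subst h; simp [adjM]
    · simp [indS, h]
  · intro u _ hu; simp [indS, hu]
  · simp

lemma cutQ_remove {W : Type*} [Fintype W] {G : SimpleGraph W}
    (hreg : ∀ w : W, Nat.card (G.neighborSet w) = 4) (S : Finset W) (w : W) (hw : w ∈ S) :
    cutQ (adjM G) (indS (S.erase w)) =
      cutQ (adjM G) (indS S) - 4 + 2 * ∑ v, adjM G w v * indS S v := by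
  have e : indS (S.erase w) = fun u => indS S u - if u = w then 1 else 0 := by
    funext u
    by_cases h : u = w
    · subst h; simp [indS, hw]
    · simp [indS, h]
  have h4 : ∑ v, adjM G w v = 4 := by rw [sum_adjM, hreg]; rfl
  have hs : ∀ u v, adjM G u v = adjM G v u := fun u v => by simp [adjM, G.adj_comm]
  have h0 : adjM G w w = 0 := by simp [adjM]
  rw [e]
  unfold cutQ
  have : ∀ u v, adjM G u v * ((indS S u - if u = w then 1 else 0) *
      (1 - (indS S v - if v = w then 1 else 0))) =
      adjM G u v * (indS S u * (1 - indS S v)) - (if u = w then adjM G w v * (1 - indS S v) else 0)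
      + (if v = w then adjM G w u * indS S u else 0) := by
    intro u v
    by_cases hu : u = w <;> by_cases hv : v = w
    · subst hu; subst hv; simp [h0]
    · simp [hu, hv]; ring
    · simp [hu, hv, hs u w]; ring
    · simp [hu, hv]
  simp only [this, Finset.sum_add_distrib, Finset.sum_sub_distrib]
  have h1 : ∑ u, ∑ v, (if u = w then adjM G w v * (1 - indS S v) else 0) =
      4 - ∑ v, adjM G w v * indS S v := by
    rw [Finset.sum_comm]
    simp [mul_sub, Finset.sum_sub_distrib, h4]
  rw [h1]
  simp
  ring

lemma cut_small2 {W : Type*} [Fintype W] {G : SimpleGraph W}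
    (hreg : ∀ w : W, Nat.card (G.neighborSet w) = 4) (S : Finset W) (hS : S.card = 2) :
    4 < cutQ (adjM G) (indS S) := by
  obtain ⟨p, q, hpq, rfl⟩ := Finset.card_eq_two.1 hS
  have h := cutQ_remove hreg {p, q} p (by simp)
  have e : ({p, q} : Finset W).erase p = {q} := by
    ext u; simp
    rintro rfl; exact hpq.symm
  rw [e, cut_small1 hreg] at h
  have : ∑ v, adjM G p v * indS {p, q} v ≤ 1 := by
    rw [Finset.sum_eq_single q]
    · simp only [adjM, indS]; split_ifs <;> simp
    · intro v _ hv
      by_cases h : v = p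
      · subst h; simp [adjM]
      · simp [indS, h, hv]
    · simp
  linarith

lemma BigCuts.connected {W : Type*} [Fintype W] {G : SimpleGraph W} (h : BigCuts G)
    (hreg : ∀ w : W, Nat.card (G.neighborSet w) = 4) (h5 : 5 ≤ Fintype.card W) : G.Connected := by
  have : Nonempty W := Fintype.card_pos_iff.1 (by omega)
  by_contra hc
  obtain ⟨S, p, q, hp, hq, hS⟩ := exists_sep hc
  have h0 : cutQ (adjM G) (indS S) = 0 := by
    rw [cutQ_card]
    simp only [Nat.cast_eq_zero, Finset.card_eq_zero, cutPairs]
    ext ⟨u, v⟩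
    simp
    intro h1 h2
    by_contra h3
    exact hS u v h2 h3 h1
  have c1 : 0 < S.card := Finset.card_pos.2 ⟨p, hp⟩
  have c2 : 0 < Sᶜ.card := Finset.card_pos.2 ⟨q, by simpa using hq⟩
  rcases lt_or_ge S.card 2 with h1 | h1
  · obtain ⟨w, rfl⟩ := Finset.card_eq_one.1 (show S.card = 1 by omega)
    rw [cut_small1 hreg] at h0; omega
  rcases lt_or_ge Sᶜ.card 2 with h2 | h2
  · obtain ⟨w, hw⟩ := Finset.card_eq_one.1 (show Sᶜ.card = 1 by omega)
    rw [← cutQ_indS_compl, hw, cut_small1 hreg] at h0; omega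
  have := Finset.card_add_card_compl S
  have := h S h1 (by omega)
  omega

lemma incidence_eq {W : Type*} [Fintype W] {G : SimpleGraph W}
    (hreg : ∀ w : W, Nat.card (G.neighborSet w) = 4) (C : Finset (Sym2 W)) (hC : C.card = 4)
    (w : W) (hw : ∀ u, G.Adj w u → s(w, u) ∈ C) : ∀ e ∈ C, w ∈ e := by
  have hd : (G.incidenceFinset w).card = 4 := by
    rw [SimpleGraph.card_incidenceFinset_eq_degree, ← SimpleGraph.card_neighborSet_eq_degree,
      ← Nat.card_eq_fintype_card, hreg]
  have hsub : G.incidenceFinset w ⊆ C := by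
    intro e he
    induction e with
    | _ u v =>
      rw [SimpleGraph.mem_incidenceFinset, SimpleGraph.mk'_mem_incidenceSet_iff] at he
      obtain ⟨h1, rfl | rfl⟩ := he
      · exact hw _ h1
      · rw [Sym2.eq_swap]; exact hw _ h1.symm
  have := Finset.eq_of_subset_of_card_le hsub (by omega)
  intro e he
  rw [← this, SimpleGraph.mem_incidenceFinset] at he
  exact he.2

lemma cp_bigcuts {W : Type*} [Fintype W] {G : SimpleGraph W} (h : IsCompletedPrimitive G) :
    BigCuts G := by
  obtain ⟨hcon, hreg, h5, hC⟩ := h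
  intro S hS1 hS2
  replace hS2 : 2 ≤ Sᶜ.card := by
    have := Finset.card_add_card_compl S
    omega
  by_contra hlt
  rw [cutEdges_card] at hlt
  have hle : (cutEdges G S).card ≤ 4 := by omega
  have key : ∀ C : Finset (Sym2 W), cutEdges G S ⊆ C → (C : Set (Sym2 W)) ⊆ G.edgeSet → C.card = 4 →
      ∃ w, ∀ u, G.Adj w u → s(w, u) ∈ C := by
    intro C h1 h2 h3
    rcases hC C h2 (by simpa using h3) with h | ⟨w, hw⟩
    · exfalso
      obtain ⟨p, hp⟩ := Finset.card_pos.1 (show 0 < S.card by omega)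
      obtain ⟨q, hq⟩ := Finset.card_pos.1 (show 0 < Sᶜ.card by omega)
      obtain ⟨u, v, ha, hu, hv⟩ := exists_cross h S hp (by simpa using hq)
      rw [SimpleGraph.deleteEdges_adj] at ha
      exact ha.2 (h1 ((mem_cutEdges _ _ _ _).2 ⟨ha.1, Or.inl ⟨hu, hv⟩⟩))
    · refine ⟨w, fun u hu => ?_⟩
      have := hw u
      rw [SimpleGraph.deleteEdges_adj] at this
      by_contra h'
      exact this ⟨hu, by simpa using h'⟩
  have hsub : (cutEdges G S : Set (Sym2 W)) ⊆ G.edgeSet := by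
    intro e he
    induction e with
    | _ u v => exact ((mem_cutEdges _ _ _ _).1 he).1
  rcases hle.eq_or_lt with h4 | h4
  · -- exactly four cut edges
    obtain ⟨w, hw⟩ := key _ subset_rfl hsub h4
    have hinc := incidence_eq hreg _ h4 w hw
    have main : ∀ T : Finset W, 2 ≤ T.card → cutEdges G T = cutEdges G S → w ∈ T → False := by
      intro T hT hTS hwT
      obtain ⟨r, hr⟩ := Finset.card_pos.1 (show 0 < (T.erase w).card by
        rw [Finset.card_erase_of_mem hwT]; omega)
      obtain ⟨u, v, ha, hu, hv⟩ := exists_cross hcon (T.erase w) hr (Finset.notMem_erase w T)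
      rw [Finset.mem_erase] at hu
      by_cases hvw : v = w
      · subst hvw
        have := hw u ha.symm
        rw [← hTS, mem_cutEdges] at this
        tauto
      · have hvT : v ∉ T := fun h => hv (Finset.mem_erase.2 ⟨hvw, h⟩)
        have := hinc s(u, v) (by rw [← hTS, mem_cutEdges]; exact ⟨ha, Or.inl ⟨hu.2, hvT⟩⟩)
        rw [Sym2.mem_iff] at this
        rcases this with rfl | rfl
        · exact hu.1 rfl
        · exact hvw rfl
    by_cases hwS : w ∈ S
    · exact main S hS1 rfl hwS
    · exact main Sᶜ hS2 (cutEdges_compl G S) (by simpa using hwS)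
  · obtain ⟨p0, hp⟩ := Finset.card_pos.1 (show 0 < S.card by omega)
    obtain ⟨q0, hq⟩ := Finset.card_pos.1 (show 0 < Sᶜ.card by omega)
    obtain ⟨p, q, ha, hu, hv⟩ := exists_cross hcon S hp (by simpa using hq)
    have hpq : s(p, q) ∈ cutEdges G S := (mem_cutEdges _ _ _ _).2 ⟨ha, Or.inl ⟨hu, hv⟩⟩
    obtain ⟨r, hr⟩ : ∃ r, r ∉ ({p, q} : Finset W) := by
      by_contra hall
      push Not at hall
      have := Finset.card_le_card (show Finset.univ ⊆ ({p, q} : Finset W) from fun r _ => hall r)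
      have := Finset.card_le_two (a := p) (b := q)
      rw [Finset.card_univ] at *
      omega
    have hdeg : ∀ r, (G.neighborFinset r).card = 4 := fun r => by
      rw [SimpleGraph.card_neighborFinset_eq_degree, ← SimpleGraph.card_neighborSet_eq_degree,
      ← Nat.card_eq_fintype_card, hreg]
    obtain ⟨t, hrt, ht⟩ : ∃ t, G.Adj r t ∧ t ∉ ({p, q} : Finset W) := by
      by_contra hall
      push Not at hall
      have := Finset.card_le_card (show G.neighborFinset r ⊆ ({p, q} : Finset W) from
        fun t ht => hall t (by simpa using ht))
      have := Finset.card_le_two (a := p) (b := q)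
      have := hdeg r
      omega
    have hE : 4 ≤ G.edgeFinset.card := by
      rw [← hdeg p, SimpleGraph.card_neighborFinset_eq_degree,
        ← SimpleGraph.card_incidenceFinset_eq_degree]
      exact Finset.card_le_card (SimpleGraph.incidenceFinset_subset _ _)
    have hsub2 : insert s(r, t) (cutEdges G S) ⊆ G.edgeFinset := by
      intro e he
      rw [Finset.mem_insert] at he
      rw [SimpleGraph.mem_edgeFinset]
      rcases he with rfl | he
      · exact hrt
      · exact hsub he
    obtain ⟨C, hC1, hC2, hC3⟩ := Finset.exists_subsuperset_card_eq hsub2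
      ((Finset.card_insert_le _ _).trans h4) hE
    obtain ⟨w, hw⟩ := key C ((Finset.subset_insert _ _).trans hC1)
      (fun e he => by simpa using hC2 he) hC3
    have hinc := incidence_eq hreg C hC3 w hw
    have i1 := hinc _ (hC1 (Finset.mem_insert_of_mem hpq))
    have i2 := hinc _ (hC1 (Finset.mem_insert_self _ _))
    simp only [Sym2.mem_iff] at i1 i2
    simp only [Finset.mem_insert, Finset.mem_singleton, not_or] at hr ht
    rcases i1 with rfl | rfl <;> rcases i2 with rfl | rfl <;> tauto

lemma bigcuts_cp {W : Type*} [Fintype W] {G : SimpleGraph W} (h : BigCuts G)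
    (hreg : ∀ w : W, Nat.card (G.neighborSet w) = 4) (h5 : 5 ≤ Fintype.card W) :
    IsCompletedPrimitive G := by
  have : Nonempty W := Fintype.card_pos_iff.1 (by omega)
  refine ⟨h.connected hreg h5, hreg, h5, fun C hC1 hC2 => ?_⟩
  by_contra! hcon
  obtain ⟨hnc, hni⟩ := hcon
  obtain ⟨S, p, q, hp, hq, hS⟩ := exists_sep hnc
  have hsub : (cutEdges G S) ⊆ C.toFinset := by
    intro e he
    induction e with
    | _ u v =>
      rw [mem_cutEdges] at he
      rw [Set.mem_toFinset]
      by_contra hn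
      obtain ⟨ha, ⟨h1, h2⟩ | ⟨h1, h2⟩⟩ := he
      · exact hS u v h1 h2 (SimpleGraph.deleteEdges_adj.2 ⟨ha, hn⟩)
      · exact hS v u h1 h2 (SimpleGraph.deleteEdges_adj.2 ⟨ha, hn⟩).symm
  have hle : cutQ (adjM G) (indS S) ≤ 4 := by
    rw [cutEdges_card]
    have := Finset.card_le_card hsub
    rw [Set.toFinset_card, ← Nat.card_eq_fintype_card, hC2] at this
    exact_mod_cast this
  have c1 : 0 < S.card := Finset.card_pos.2 ⟨p, hp⟩
  have c2 : 0 < Sᶜ.card := Finset.card_pos.2 ⟨q, by simpa using hq⟩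
  rcases lt_or_ge S.card 2 with h1 | h1
  · obtain ⟨w, rfl⟩ := Finset.card_eq_one.1 (show S.card = 1 by omega)
    obtain ⟨u, hu⟩ := hni w
    exact hS w u (by simp) (by simpa using hu.ne.symm) hu
  rcases lt_or_ge Sᶜ.card 2 with h2 | h2
  · obtain ⟨w, hw⟩ := Finset.card_eq_one.1 (show Sᶜ.card = 1 by omega)
    obtain ⟨u, hu⟩ := hni w
    have hw' : ∀ v, v ∉ S ↔ v = w := fun v => by rw [← Finset.mem_compl, hw, Finset.mem_singleton]
    refine hS u w ?_ ((hw' w).2 rfl) hu.symm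
    by_contra hn
    exact hu.ne ((hw' u).1 hn).symm
  have := Finset.card_add_card_compl S
  have := h S h1 (by omega)
  omega

/-- adjacency away from b -/
noncomputable def adj0 {W : Type*} (G : SimpleGraph W) (b u v : W) : ℤ :=
  if u ≠ b ∧ v ≠ b ∧ G.Adj u v then 1 else 0

/-- delta -/
noncomputable def dl {W : Type*} (p u : W) : ℤ := if u = p then 1 else 0

lemma sum_dl {W : Type*} [Fintype W] (p : W) (f : W → ℤ) : ∑ u, dl p u * f u = f p := by
  simp [dl]

lemma sum_dl1 {W : Type*} [Fintype W] (p : W) : ∑ u, dl p u = 1 := by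
  simp [dl]

lemma nb_b {W : Type*} [Fintype W] {Γ : SimpleGraph W}
    (hreg : ∀ w : W, Nat.card (Γ.neighborSet w) = 4)
    {a b c d x : W} (hdt : DTConfig Γ a b c d x) (u : W) :
    Γ.Adj b u ↔ u = a ∨ u = c ∨ u = d ∨ u = x := by
  obtain ⟨hab, hac, hbc, had, hbd, hcd, hy, hbx, hxa, hxc, hxd, ncd, nax⟩ := hdt
  have hc : (Γ.neighborFinset b).card = 4 := by
    rw [SimpleGraph.card_neighborFinset_eq_degree, ← SimpleGraph.card_neighborSet_eq_degree,
      ← Nat.card_eq_fintype_card, hreg]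
  have hs : ({a, c, d, x} : Finset W) ⊆ Γ.neighborFinset b := by
    intro v hv
    simp only [Finset.mem_insert, Finset.mem_singleton] at hv
    rw [SimpleGraph.mem_neighborFinset]
    rcases hv with rfl | rfl | rfl | rfl
    · exact hab.symm
    · exact hbc
    · exact hbd
    · exact hbx
  have h4 : ({a, c, d, x} : Finset W).card = 4 := by
    rw [Finset.card_insert_of_notMem, Finset.card_insert_of_notMem, Finset.card_insert_of_notMem,
      Finset.card_singleton]
    · simpa using hxd.symm
    · simp [hcd, hxc.symm]
    · simp [hac.ne, had.ne, hxa.symm]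
  have := Finset.eq_of_subset_of_card_le hs (by omega)
  rw [← SimpleGraph.mem_neighborFinset, ← this]
  simp

lemma adjM_eq {W : Type*} [Fintype W] {Γ : SimpleGraph W}
    (hreg : ∀ w : W, Nat.card (Γ.neighborSet w) = 4)
    {a b c d x : W} (hdt : DTConfig Γ a b c d x) (u v : W) :
    adjM Γ u v = adj0 Γ b u v + dl b u * (dl a v + dl c v + dl d v + dl x v)
      + dl b v * (dl a u + dl c u + dl d u + dl x u) := by
  have key : ∀ v, (if Γ.Adj b v then (1 : ℤ) else 0) = dl a v + dl c v + dl d v + dl x v := by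
    intro v
    have hn := nb_b hreg hdt v
    obtain ⟨hab, hac, hbc, had, hbd, hcd, hy, hbx, hxa, hxc, hxd, ncd, nax⟩ := hdt
    have h1 := hac.ne
    have h2 := had.ne
    simp only [hn, dl]
    by_cases e1 : v = a
    · subst e1; simp [h1, h2, hxa.symm]
    by_cases e2 : v = c
    · subst e2; simp [e1, hcd, hxc.symm]
    by_cases e3 : v = d
    · subst e3; simp [e1, e2, hxd.symm]
    simp [e1, e2, e3]
  rw [← key, ← key]
  by_cases hu : u = b
  · subst hu
    by_cases hv : v = u
    · subst hv; simp [adjM, adj0, dl]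
    · simp [adjM, adj0, dl, hv]
  · by_cases hv : v = b
    · subst hv; simp [adjM, adj0, dl, hu, Γ.adj_comm]
    · simp [adjM, adj0, dl, hu, hv]

lemma adjM'_eq {W : Type*} [Fintype W] {Γ : SimpleGraph W}
    {a b c d x : W} (hdt : DTConfig Γ a b c d x) (u v : {u : W // u ≠ b}) :
    adjM (dtReduced Γ a b c d x) u v = adj0 Γ b u v + dl c u.1 * dl d v.1 + dl d u.1 * dl c v.1
      + dl a u.1 * dl x v.1 + dl x u.1 * dl a v.1 := by
  obtain ⟨u, hu⟩ := u
  obtain ⟨v, hv⟩ := v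
  obtain ⟨hab, hac, hbc, had, hbd, hcd, hy, hbx, hxa, hxc, hxd, ncd, nax⟩ := hdt
  have h1 := hac.ne
  have h2 := had.ne
  have ndc : ¬ Γ.Adj d c := fun h => ncd h.symm
  have nxa : ¬ Γ.Adj x a := fun h => nax h.symm
  have hne : Γ.Adj u v → u ≠ v := fun h => h.ne
  simp only [adjM, adj0, dl, dtReduced, SimpleGraph.fromRel_adj, ne_eq, Subtype.mk.injEq, hu, hv,
    not_false_eq_true, true_and, Γ.adj_comm v u]
  by_cases hA : Γ.Adj u v
  · have e1 : ¬ (u = c ∧ v = d) := by rintro ⟨rfl, rfl⟩; exact ncd hA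
    have e2 : ¬ (u = d ∧ v = c) := by rintro ⟨rfl, rfl⟩; exact ndc hA
    have e3 : ¬ (u = a ∧ v = x) := by rintro ⟨rfl, rfl⟩; exact nax hA
    have e4 : ¬ (u = x ∧ v = a) := by rintro ⟨rfl, rfl⟩; exact nxa hA
    have e0 := hne hA
    simp only [hA, e0, ← ite_and, mul_ite, mul_one, mul_zero]
    grind
  · simp only [hA]
    grind

lemma sum_sub_b {W : Type*} [Fintype W] (b : W) (f : W → ℤ) (hf : f b = 0) :
    ∑ u : {u : W // u ≠ b}, f u.1 = ∑ u, f u := by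
  rw [← Finset.sum_erase (Finset.univ) hf]
  exact (Finset.sum_subtype (Finset.univ.erase b) (p := fun u => u ≠ b) (by simp) f).symm

lemma cutQ_eq {W : Type*} [Fintype W] {Γ : SimpleGraph W}
    (hreg : ∀ w : W, Nat.card (Γ.neighborSet w) = 4)
    {a b c d x : W} (hdt : DTConfig Γ a b c d x) (s : W → ℤ) :
    cutQ (adjM Γ) s = cutQ (adj0 Γ b) s + s b * (4 - (s a + s c + s d + s x))
      + (1 - s b) * (s a + s c + s d + s x) := by
  unfold cutQ
  have h : ∀ u v, adjM Γ u v * (s u * (1 - s v)) = adj0 Γ b u v * (s u * (1 - s v)) +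
     dl b u * (s u * (dl a v * (1 - s v) + dl c v * (1 - s v) + dl d v * (1 - s v) +
      dl x v * (1 - s v))) + dl b v * ((1 - s v) * (dl a u * s u + dl c u * s u + dl d u * s u
      + dl x u * s u)) := by
    intro u v; rw [adjM_eq hreg hdt]; ring
  simp only [h, Finset.sum_add_distrib, ← Finset.mul_sum, sum_dl]
  ring

lemma adj0_b1 {W : Type*} (Γ : SimpleGraph W) (b v : W) : adj0 Γ b b v = 0 := by simp [adj0]
lemma adj0_b2 {W : Type*} (Γ : SimpleGraph W) (b v : W) : adj0 Γ b v b = 0 := by simp [adj0]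

lemma cutQ'_eq {W : Type*} [Fintype W] {Γ : SimpleGraph W}
    {a b c d x : W} (hdt : DTConfig Γ a b c d x) (s : W → ℤ) :
    cutQ (adjM (dtReduced Γ a b c d x)) (fun u => s u.1) =
      cutQ (adj0 Γ b) s + s c * (1 - s d) + s d * (1 - s c) + s a * (1 - s x) + s x * (1 - s a)
      := by
  unfold cutQ
  have hb : dl a b = 0 ∧ dl c b = 0 ∧ dl d b = 0 ∧ dl x b = 0 := by
    obtain ⟨hab, hac, hbc, had, hbd, hcd, hy, hbx, hxa, hxc, hxd, ncd, nax⟩ := hdt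
    simp [dl, hab.ne.symm, hbc.ne, hbd.ne, hbx.ne]
  obtain ⟨b1, b2, b3, b4⟩ := hb
  have h : ∀ u v : {u : W // u ≠ b}, adjM (dtReduced Γ a b c d x) u v * (s u.1 * (1 - s v.1)) =
     (fun u v : W => adj0 Γ b u v * (s u * (1 - s v)) + dl c u * (s u * (dl d v * (1 - s v)))
      + dl d u * (s u * (dl c v * (1 - s v))) + dl a u * (s u * (dl x v * (1 - s v)))
      + dl x u * (s u * (dl a v * (1 - s v)))) u.1 v.1 := by
    intro u v; rw [adjM'_eq hdt]; ring
  simp only [h]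
  rw [sum_sub_b b (fun u => ∑ v : {u : W // u ≠ b}, (fun u v : W => adj0 Γ b u v * (s u * (1 - s v))
      + dl c u * (s u * (dl d v * (1 - s v)))
      + dl d u * (s u * (dl c v * (1 - s v))) + dl a u * (s u * (dl x v * (1 - s v)))
      + dl x u * (s u * (dl a v * (1 - s v)))) u v.1)
      (by simp [adj0_b1, b1, b2, b3, b4])]
  have h2 : ∀ u : W, ∑ v : {u : W // u ≠ b}, (fun u v : W => adj0 Γ b u v * (s u * (1 - s v))
      + dl c u * (s u * (dl d v * (1 - s v)))
      + dl d u * (s u * (dl c v * (1 - s v))) + dl a u * (s u * (dl x v * (1 - s v)))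
      + dl x u * (s u * (dl a v * (1 - s v)))) u v.1 = ∑ v, (adj0 Γ b u v * (s u * (1 - s v))
      + dl c u * (s u * (dl d v * (1 - s v)))
      + dl d u * (s u * (dl c v * (1 - s v))) + dl a u * (s u * (dl x v * (1 - s v)))
      + dl x u * (s u * (dl a v * (1 - s v)))) := by
    intro u
    exact sum_sub_b b (fun v => adj0 Γ b u v * (s u * (1 - s v))
      + dl c u * (s u * (dl d v * (1 - s v)))
      + dl d u * (s u * (dl c v * (1 - s v))) + dl a u * (s u * (dl x v * (1 - s v)))
      + dl x u * (s u * (dl a v * (1 - s v)))) (by simp [adj0_b2, b1, b2, b3, b4])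
  simp only [h2]
  simp only [Finset.sum_add_distrib, ← Finset.mul_sum, sum_dl]

lemma reg' {W : Type*} [Fintype W] {Γ : SimpleGraph W}
    (hreg : ∀ w : W, Nat.card (Γ.neighborSet w) = 4)
    {a b c d x : W} (hdt : DTConfig Γ a b c d x) (u : {u : W // u ≠ b}) :
    Nat.card ((dtReduced Γ a b c d x).neighborSet u) = 4 := by
  have h1 := sum_adjM (G := dtReduced Γ a b c d x) u
  have h2 := sum_adjM (G := Γ) u.1
  rw [hreg] at h2
  have hb : dl a b = 0 ∧ dl c b = 0 ∧ dl d b = 0 ∧ dl x b = 0 := by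
    obtain ⟨hab, hac, hbc, had, hbd, hcd, hy, hbx, hxa, hxc, hxd, ncd, nax⟩ := hdt
    simp [dl, hab.ne.symm, hbc.ne, hbd.ne, hbx.ne]
  obtain ⟨b1, b2, b3, b4⟩ := hb
  have hub : dl b u.1 = 0 := by simp [dl, u.2]
  simp only [adjM_eq hreg hdt, hub, zero_mul, add_zero, Finset.sum_add_distrib, ← Finset.sum_mul,
    sum_dl1] at h2
  simp only [adjM'_eq hdt] at h1
  rw [sum_sub_b b (fun v => adj0 Γ b u v + dl c u.1 * dl d v + dl d u.1 * dl c v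
      + dl a u.1 * dl x v + dl x u.1 * dl a v) (by simp [adj0_b2, b1, b2, b3, b4])] at h1
  simp only [Finset.sum_add_distrib, ← Finset.mul_sum, sum_dl1] at h1
  push_cast at h2
  zify
  linarith

lemma indS_sub {W : Type*} (b : W) (S : Finset W) :
    indS (S.subtype (fun u => u ≠ b)) = fun u => indS S u.1 := by
  funext u; simp [indS]

lemma cutQ0_congr {W : Type*} [Fintype W] (Γ : SimpleGraph W) (b : W) (s t : W → ℤ)
    (h : ∀ u, u ≠ b → s u = t u) : cutQ (adj0 Γ b) s = cutQ (adj0 Γ b) t := by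
  unfold cutQ
  refine Finset.sum_congr rfl fun u _ => Finset.sum_congr rfl fun v _ => ?_
  by_cases hu : u = b
  · subst hu; simp [adj0_b1]
  by_cases hv : v = b
  · subst hv; simp [adj0_b2]
  rw [h u hu, h v hv]

lemma indS_cases {W : Type*} (S : Finset W) (u : W) : indS S u = 0 ∨ indS S u = 1 := by
  unfold indS; split_ifs <;> simp

lemma indS_one {W : Type*} (S : Finset W) (u : W) : indS S u = 1 ↔ u ∈ S := by
  unfold indS; split_ifs with h <;> simp [h]

lemma indS_zero {W : Type*} (S : Finset W) (u : W) : indS S u = 0 ↔ u ∉ S := by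
  unfold indS; split_ifs with h <;> simp [h]

lemma card_sub_b {W : Type*} [Fintype W] (b : W) :
    Fintype.card {u : W // u ≠ b} + 1 = Fintype.card W := by
  have := Fintype.card_pos_iff.2 ⟨b⟩
  rw [Fintype.card_subtype_compl]
  simp
  omega

lemma forward {W : Type*} [Fintype W] {Γ : SimpleGraph W}
    (hreg : ∀ w : W, Nat.card (Γ.neighborSet w) = 4)
    {a b c d x : W} (hdt : DTConfig Γ a b c d x) (h : BigCuts (dtReduced Γ a b c d x)) :
    BigCuts Γ := by
  have main : ∀ S : Finset W, b ∉ S → 2 ≤ S.card → S.card + 2 ≤ Fintype.card W →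
      4 < cutQ (adjM Γ) (indS S) := by
    intro S hb h1 h2
    rcases h2.eq_or_lt with h2 | h2
    · obtain ⟨U, -, hU, e⟩ := exists_compl Γ S
      rw [← e]; exact cut_small2 hreg _ (by omega)
    have c1 : (S.subtype (fun u => u ≠ b)).card = S.card := by
      rw [Finset.card_subtype, Finset.filter_true_of_mem]
      rintro u hu rfl; exact hb hu
    have c2 := card_sub_b b
    have := h (S.subtype (fun u => u ≠ b)) (by omega) (by omega)
    rw [indS_sub, cutQ'_eq hdt] at this
    rw [cutQ_eq hreg hdt]
    have hb0 : indS S b = 0 := by simp [indS, hb]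
    rw [hb0]
    rcases indS_cases S a with e1 | e1 <;> rcases indS_cases S c with e2 | e2 <;>
      rcases indS_cases S d with e3 | e3 <;> rcases indS_cases S x with e4 | e4 <;>
      rw [e1, e2, e3, e4] at this ⊢ <;> linarith
  intro S h1 h2
  by_cases hb : b ∈ S
  · obtain ⟨U, hU, hU2, e⟩ := exists_compl Γ S
    rw [← e]
    exact main U (by rw [hU]; simpa using hb) (by omega) (by omega)
  · exact main S hb h1 h2

lemma backward {W : Type*} [Fintype W] {Γ : SimpleGraph W}
    (hreg : ∀ w : W, Nat.card (Γ.neighborSet w) = 4)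
    {a b c d x : W} (hdt : DTConfig Γ a b c d x) (h : BigCuts Γ) :
    BigCuts (dtReduced Γ a b c d x) := by
  have main : ∀ S : Finset {u : W // u ≠ b}, 2 ≤ S.card → S.card + 2 ≤ Fintype.card {u : W // u ≠ b} →
      ¬ ((∀ u ∈ S, u.1 ≠ a ∧ u.1 ≠ x) ∧ (∀ u ∉ S, u.1 ≠ c ∧ u.1 ≠ d)) →
      4 < cutQ (adjM (dtReduced Γ a b c d x)) (indS S) := by
    intro S h1 h2 hex
    rcases h1.eq_or_lt with h1 | h1
    · exact cut_small2 (reg' hreg hdt) _ h1.symm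
    set T : Finset W := S.map (Function.Embedding.subtype _) with hT
    have hbT : b ∉ T := by simp [hT]
    have hTS : ∀ u : {u : W // u ≠ b}, u.1 ∈ T ↔ u ∈ S := by
      intro u; simp [hT, u.2]
    have hST : indS S = fun u => indS T u.1 := by
      funext u
      by_cases hu : u ∈ S
      · rw [(indS_one _ _).2 hu, (indS_one _ _).2 ((hTS u).2 hu)]
      · rw [(indS_zero _ _).2 hu, (indS_zero _ _).2 (fun h => hu ((hTS u).1 h))]
    have c1 : T.card = S.card := by simp [hT]
    have c2 := card_sub_b b
    have d1 : (insert b T).card = S.card + 1 := by rw [Finset.card_insert_of_notMem hbT, c1]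
    have g1 := h T (by omega) (by omega)
    have g2 := h (insert b T) (by omega) (by omega)
    have hb0 : indS T b = 0 := by simp [indS, hbT]
    have hb1 : indS (insert b T) b = 1 := by simp [indS]
    have hins : ∀ u, u ≠ b → indS (insert b T) u = indS T u := by
      intro u hu; simp [indS, hu]
    obtain ⟨hab, hac, hbc, had, hbd, hcd, hy, hbx, hxa, hxc, hxd, ncd, nax⟩ := id hdt
    rw [cutQ_eq hreg hdt] at g1 g2
    rw [cutQ0_congr Γ b _ _ hins, hb1, hins a hab.ne, hins c hbc.ne.symm, hins d hbd.ne.symm,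
      hins x hbx.ne.symm] at g2
    rw [hST, cutQ'_eq hdt]
    rw [hb0] at g1
    by_cases hspec : a ∈ T ∧ x ∈ T ∧ c ∉ T ∧ d ∉ T
    · obtain ⟨ha, hx, hc, hd⟩ := hspec
      have e1 : indS T a = 1 := by simp [indS, ha]
      have e2 : indS T x = 1 := by simp [indS, hx]
      have e3 : indS T c = 0 := by simp [indS, hc]
      have e4 : indS T d = 0 := by simp [indS, hd]
      have k1 : (T.erase a).card = S.card - 1 := by rw [Finset.card_erase_of_mem ha, c1]
      have g := h (T.erase a) (by omega) (by omega)
      rw [cutQ_remove hreg T a ha, cutQ_eq hreg hdt, hb0] at g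
      have hs : ∑ v, adjM Γ a v * indS T v ≤ 1 := by
        have h4 : ∑ v, adjM Γ a v = 4 := by rw [sum_adjM, hreg]; rfl
        have h3 : ∑ v ∈ ({b, c, d} : Finset W), adjM Γ a v * (1 - indS T v) = 3 := by
          rw [Finset.sum_insert (by simp [hbc.ne, hbd.ne]), Finset.sum_insert (by simp [hcd]),
            Finset.sum_singleton, hb0, e3, e4]
          simp [adjM, hab, hac, had]
        have h5 : ∑ v ∈ ({b, c, d} : Finset W), adjM Γ a v * (1 - indS T v) ≤
            ∑ v, adjM Γ a v * (1 - indS T v) := by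
          refine Finset.sum_le_sum_of_subset_of_nonneg (Finset.subset_univ _) fun v _ _ => ?_
          apply mul_nonneg
          · unfold adjM; split_ifs <;> simp
          · rcases indS_cases T v with h | h <;> rw [h] <;> simp
        simp only [mul_sub, mul_one, Finset.sum_sub_distrib, h4] at h5 h3
        linarith
      rw [e1, e2, e3, e4] at g ⊢
      linarith
    · have hspec2 : ¬ (a ∉ T ∧ x ∉ T ∧ c ∈ T ∧ d ∈ T) := by
        rintro ⟨ha, hx, hc, hd⟩
        apply hex
        constructor
        · intro u hu
          rw [← hTS] at hu
          exact ⟨fun e => ha (e ▸ hu), fun e => hx (e ▸ hu)⟩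
        · intro u hu
          rw [← hTS] at hu
          exact ⟨fun e => hu (e ▸ hc), fun e => hu (e ▸ hd)⟩
      simp only [← indS_one] at hspec hspec2
      have ca := indS_cases T a
      have cc := indS_cases T c
      have cd := indS_cases T d
      have cx := indS_cases T x
      clear hST
      generalize cutQ (adj0 Γ b) (indS T) = Q at g1 g2 ⊢
      generalize indS T a = sa, indS T c = sc, indS T d = sd, indS T x = sx at *
      rcases ca with rfl | rfl <;> rcases cc with rfl | rfl <;> rcases cd with rfl | rfl <;>
        rcases cx with rfl | rfl <;> first | linarith | (exfalso; simp at hspec; done) | (exfalso; simp at hspec2; done)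
  intro S h1 h2
  by_cases hex : (∀ u ∈ S, u.1 ≠ a ∧ u.1 ≠ x) ∧ (∀ u ∉ S, u.1 ≠ c ∧ u.1 ≠ d)
  · obtain ⟨U, hU, hU2, e⟩ := exists_compl (dtReduced Γ a b c d x) S
    rw [← e]
    refine main U (by omega) (by omega) ?_
    rintro ⟨h3, -⟩
    have hab := hdt.1.ne
    by_cases ha : (⟨a, hab⟩ : {u : W // u ≠ b}) ∈ S
    · exact (hex.1 _ ha).1 rfl
    · exact (h3 _ ((hU _).2 ha)).1 rfl
  · exact main S h1 h2 hex

theorem stmt18 {W : Type*} [Fintype W] (Γ : SimpleGraph W) (hconn : Γ.Connected)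
    (hreg : ∀ w : W, Nat.card (Γ.neighborSet w) = 4) (hW : 6 ≤ Fintype.card W)
    (a b c d x : W) (hdt : DTConfig Γ a b c d x) :
    IsCompletedPrimitive (dtReduced Γ a b c d x) ↔ IsCompletedPrimitive Γ := by

  constructor
  · intro h
    exact bigcuts_cp (forward hreg hdt (cp_bigcuts h)) hreg (by omega)
  · intro h
    refine bigcuts_cp (backward hreg hdt (cp_bigcuts h)) (reg' hreg hdt) ?_
    rw [Fintype.card_subtype_compl]
    simp
    omega
end

section
/- Let K₄ be the complete graph on 4 vertices with edges e₁, …, e₆. Then the period of K₄ is P(K₄) = ∫_{(0,∞)⁵} dx₁ ⋯ dx₅ / Ψ_{K₄}(x₁, …, x₅, 1)² = 6 ζ(3), where ζ(3) = Σ_{n≥1} 1/n³. (Equivalently, the period of the completed primitive graph K₅ is P_{K₅} = 6 ζ(3).) -/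
open scoped Classical
open Matrix

/-- The period integral of `G` with the variable of the edge `e₀` set to `1`,
integrated over the open positive orthant in the remaining edge variables. -/
noncomputable def graphPeriod {V : Type*} [Fintype V] (G : SimpleGraph V)
    (e₀ : G.edgeSet) : ℝ :=
  letI : Fintype G.edgeSet := Fintype.ofFinite _
  ∫ x in (Set.univ.pi fun _ : {e : G.edgeSet // e ≠ e₀} => Set.Ioi (0 : ℝ)),
    1 / (MvPolynomial.aeval (fun e : G.edgeSet =>
      if h : e = e₀ then (1 : ℝ) else x ⟨e, h⟩) (graphPoly G)) ^ 2

open MeasureTheory Set Filter Topology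

lemma ftcIoi {g g' : ℝ → ℝ} {a l : ℝ} (h : ∀ x ∈ Ici a, HasDerivAt g (g' x) x)
    (h0 : ∀ x ∈ Ioi a, 0 ≤ g' x) (hl : Tendsto g atTop (𝓝 l)) :
    ∫⁻ x in Ioi a, ENNReal.ofReal (g' x) = ENNReal.ofReal (l - g a) := by
  rw [← integral_Ioi_of_hasDerivAt_of_nonneg' h h0 hl,
    ofReal_integral_eq_lintegral_ofReal (integrableOn_Ioi_deriv_of_nonneg' h h0 hl)]
  exact (ae_restrict_iff' measurableSet_Ioi).2 (Eventually.of_forall h0)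

lemma ftcIoo {g g' : ℝ → ℝ} {a b : ℝ} (hab : a ≤ b) (h : ∀ x ∈ Icc a b, HasDerivAt g (g' x) x)
    (h0 : ∀ x ∈ Ioo a b, 0 ≤ g' x) :
    ∫⁻ x in Ioo a b, ENNReal.ofReal (g' x) = ENNReal.ofReal (g b - g a) := by
  have hi : IntegrableOn g' (Ioc a b) volume :=
    intervalIntegral.integrableOn_deriv_of_nonneg
      (fun x hx => (h x hx).continuousAt.continuousWithinAt)
      (fun x hx => h x (Ioo_subset_Icc_self hx)) h0
  have := intervalIntegral.integral_eq_sub_of_hasDerivAt (a := a) (b := b) (f := g) (f' := g')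
    (by rwa [uIcc_of_le hab]) ((intervalIntegrable_iff_integrableOn_Ioc_of_le hab).2 hi)
  rw [← this, intervalIntegral.integral_of_le hab, integral_Ioc_eq_integral_Ioo,
    ofReal_integral_eq_lintegral_ofReal (hi.mono_set Ioo_subset_Ioc_self)]
  exact (ae_restrict_iff' measurableSet_Ioo).2 (Eventually.of_forall h0)

lemma lint_sq {A B : ℝ} (hA : 0 < A) (hB : 0 < B) :
    ∫⁻ x in Ioi (0:ℝ), ENNReal.ofReal (1 / (A * x + B) ^ 2) = ENNReal.ofReal (1 / (A * B)) := by
  have := ftcIoi (a := 0) (l := 0) (g := fun x => - (1 / A) * (A * x + B)⁻¹)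
    (g' := fun x => 1 / (A * x + B) ^ 2) ?_ ?_ ?_
  · rw [this]; congr 1; simp; field_simp
  · intro x hx
    have hx : 0 ≤ x := hx
    have hp : A * x + B ≠ 0 := by positivity
    have h1 : HasDerivAt (fun x => A * x + B) A x := by
      simpa using ((hasDerivAt_id x).const_mul A).add_const B
    refine ((h1.inv hp).const_mul (-(1 / A))).congr_deriv ?_
    field_simp
  · intro x hx; positivity
  · have h1 : Tendsto (fun x => A * x + B) atTop atTop :=
      tendsto_atTop_add_const_right _ _ (tendsto_id.const_mul_atTop hA)
    simpa using h1.inv_tendsto_atTop.const_mul (-(1 / A))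

lemma lint_two {a0 a1 b0 b1 d : ℝ} (ha0 : 0 < a0) (ha1 : 0 < a1) (hb0 : 0 < b0) (hb1 : 0 < b1)
    (hd : 0 < d) (h : a0 * b1 - a1 * b0 = d) :
    ∫⁻ x in Ioi (0:ℝ), ENNReal.ofReal (1 / ((a1 * x + a0) * (b1 * x + b0))) =
      ENNReal.ofReal (Real.log (a0 * b1 / (a1 * b0)) / d) := by
  have lin : ∀ c e x : ℝ, HasDerivAt (fun x => c * x + e) c x := by
    intro c e x
    simpa using ((hasDerivAt_id x).const_mul c).add_const e
  have := ftcIoi (a := 0) (l := Real.log (b1 / a1) / d)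
    (g := fun x => Real.log ((b1 * x + b0) / (a1 * x + a0)) / d)
    (g' := fun x => 1 / ((a1 * x + a0) * (b1 * x + b0))) ?_ ?_ ?_
  · rw [this]; congr 1
    rw [← sub_div]
    congr 1
    simp only [mul_zero, zero_add]
    rw [← Real.log_div (by positivity) (by positivity)]
    congr 1; field_simp
  · intro x hx
    have hx : 0 ≤ x := hx
    have hp : a1 * x + a0 ≠ 0 := by positivity
    have hq : b1 * x + b0 ≠ 0 := by positivity
    have := (((lin b1 b0 x).div (lin a1 a0 x) hp).log (div_ne_zero hq hp)).div_const d
    refine this.congr_deriv ?_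
    simp only [Pi.div_apply]
    field_simp
    linarith
  · intro x hx
    have hx : 0 < x := hx
    positivity
  · have h1 : Tendsto (fun x : ℝ => (b1 + b0 * x⁻¹) / (a1 + a0 * x⁻¹)) atTop (𝓝 (b1 / a1)) := by
      have := ((tendsto_inv_atTop_zero (𝕜 := ℝ)).const_mul b0).const_add b1
      have h2 := ((tendsto_inv_atTop_zero (𝕜 := ℝ)).const_mul a0).const_add a1
      have h3 := this.div h2 (by simp; positivity)
      simp only [mul_zero, add_zero] at h3
      exact h3
    have h2 : Tendsto (fun x : ℝ => (b1 * x + b0) / (a1 * x + a0)) atTop (𝓝 (b1 / a1)) := by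
      refine h1.congr' ?_
      filter_upwards [eventually_gt_atTop 0] with x hx
      field_simp
    exact (h2.log (by positivity)).div_const d

lemma lint_scale {c : ℝ} (hc : 0 < c) (f : ℝ → ENNReal) :
    ∫⁻ y in Ioi (0:ℝ), f y = ∫⁻ j in Ioi (0:ℝ), ENNReal.ofReal c * f (c * j) := by
  have := lintegral_image_eq_lintegral_abs_deriv_mul (s := Ioi (0:ℝ)) (f := fun j => c * j)
    (f' := fun _ => c) measurableSet_Ioi
    (fun x _ => by simpa using ((hasDerivAt_id x).const_mul c).hasDerivWithinAt)
    (fun x _ y _ h => by simpa [hc.ne'] using h) f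
  rw [abs_of_pos hc] at this
  rw [← this]
  congr 2
  ext y
  constructor
  · intro hy
    have hy : 0 < y := hy
    exact ⟨y / c, by simp; positivity, by field_simp⟩
  · rintro ⟨j, hj, rfl⟩
    exact mul_pos hc hj

lemma lint_shift (r : ℝ) (f : ℝ → ENNReal) :
    ∫⁻ s in Ioi (0:ℝ), f (r + s) = ∫⁻ N in Ioi r, f N := by
  have := lintegral_image_eq_lintegral_abs_deriv_mul (s := Ioi (0:ℝ)) (f := fun j => r + j)
    (f' := fun _ => 1) measurableSet_Ioi
    (fun x _ => by simpa using ((hasDerivAt_id x).const_add r).hasDerivWithinAt)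
    (fun x _ y _ h => by simpa using h) f
  simp at this
  exact this.symm

lemma tri_swap (μ : Measure ℝ) [SFinite μ] (f : ℝ → ℝ → ENNReal)
    (hf : Measurable (Function.uncurry f)) :
    ∫⁻ r, ∫⁻ M in Ioi r, f r M ∂μ ∂μ = ∫⁻ M, ∫⁻ r in Iio M, f r M ∂μ ∂μ := by
  have h1 : ∀ r, ∫⁻ M in Ioi r, f r M ∂μ = ∫⁻ M, {p : ℝ × ℝ | p.1 < p.2}.indicator
      (Function.uncurry f) (r, M) ∂μ := by
    intro r
    rw [← lintegral_indicator measurableSet_Ioi]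
    rfl
  have h2 : ∀ M, ∫⁻ r in Iio M, f r M ∂μ = ∫⁻ r, {p : ℝ × ℝ | p.1 < p.2}.indicator
      (Function.uncurry f) (r, M) ∂μ := by
    intro r
    rw [← lintegral_indicator measurableSet_Iio]
    rfl
  simp_rw [h1, h2]
  apply lintegral_lintegral_swap
  exact (hf.indicator (measurableSet_lt measurable_fst measurable_snd)).aemeasurable

lemma lint_pow {n : ℝ} (hn : 0 < n) :
    ∫⁻ t in Ioi (0:ℝ), ENNReal.ofReal (t ^ 3 * Real.exp (-(n * t))) = ENNReal.ofReal (6 / n ^ 4) := by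
  have h := Real.integral_rpow_mul_exp_neg_mul_Ioi (a := 4) (r := n) (by norm_num) hn
  have hG : Real.Gamma 4 = 6 := by
    have := Real.Gamma_nat_eq_factorial 3
    rw [show (4:ℝ) = ((3:ℕ):ℝ) + 1 by norm_num, this]
    norm_num [Nat.factorial]
  have h3 : ∀ t : ℝ, t ^ ((4:ℝ) - 1) = t ^ 3 := by
    intro t
    rw [← Real.rpow_natCast]; norm_num
  simp_rw [h3] at h
  have h4 : (1 / n) ^ (4:ℝ) * Real.Gamma 4 = 6 / n ^ 4 := by
    rw [hG, show (4:ℝ) = ((4:ℕ):ℝ) by norm_num, Real.rpow_natCast]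
    field_simp
  rw [h4] at h
  rw [← h, ofReal_integral_eq_lintegral_ofReal]
  · by_contra hc
    rw [integral_undef hc] at h
    have : 0 < 6 / n ^ 4 := by positivity
    linarith
  · refine (ae_restrict_iff' measurableSet_Ioi).2 (Eventually.of_forall fun t ht => ?_)
    have : 0 < t := ht
    simp only [Pi.zero_apply]
    positivity

lemma lint_final :
    ∫⁻ N in Ioi (0:ℝ), ENNReal.ofReal (Real.log (1 + N) ^ 3 / N ^ 2) =
      ENNReal.ofReal (6 * ∑' n : ℕ, (1 : ℝ) / ((n : ℝ) + 1) ^ 3) := by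
  have himg : (fun t => Real.exp t - 1) '' Ioi (0:ℝ) = Ioi 0 := by
    ext y
    constructor
    · rintro ⟨t, ht, rfl⟩
      have ht : 0 < t := ht
      have := Real.add_one_lt_exp ht.ne'
      simp only [mem_Ioi]; linarith
    · intro hy
      have hy : 0 < y := hy
      refine ⟨Real.log (1 + y), Real.log_pos (by linarith), ?_⟩
      simp only
      rw [Real.exp_log (by linarith)]; ring
  have h1 := lintegral_image_eq_lintegral_abs_deriv_mul (s := Ioi (0:ℝ))
    (f := fun t => Real.exp t - 1)
    (f' := fun t => Real.exp t) measurableSet_Ioi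
    (fun x _ => ((Real.hasDerivAt_exp x).sub_const 1).hasDerivWithinAt)
    (fun x _ y _ h => by simpa using h)
    (fun N => ENNReal.ofReal (Real.log (1 + N) ^ 3 / N ^ 2))
  rw [himg] at h1
  rw [h1]
  have h2 : ∀ t ∈ Ioi (0:ℝ), ENNReal.ofReal |Real.exp t| *
      ENNReal.ofReal (Real.log (1 + (Real.exp t - 1)) ^ 3 / (Real.exp t - 1) ^ 2) =
      ∑' n : ℕ, ENNReal.ofReal (((n:ℝ) + 1)) * ENNReal.ofReal (t ^ 3 * Real.exp (-(((n:ℝ) + 1) * t))) := by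
    intro t ht
    have ht : 0 < t := ht
    have he : 0 < Real.exp t - 1 := by have := Real.add_one_lt_exp ht.ne'; linarith
    have hlt : ‖Real.exp (-t)‖ < 1 := by
      rw [Real.norm_eq_abs, abs_of_pos (Real.exp_pos _)]
      rw [Real.exp_lt_one_iff]; linarith
    have hs := (hasSum_coe_mul_geometric_of_norm_lt_one hlt)
    have hs1 := (hasSum_nat_add_iff' (f := fun n : ℕ => (n:ℝ) * Real.exp (-t) ^ n) 1).2 hs
    have hs2 := hs1.mul_left (t ^ 3)
    simp only [Finset.range_one, Finset.sum_singleton, Nat.cast_zero, zero_mul, sub_zero] at hs2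
    rw [← ENNReal.ofReal_mul (abs_nonneg _), abs_of_pos (Real.exp_pos _)]
    simp_rw [← ENNReal.ofReal_mul (show (0:ℝ) ≤ (_:ℕ) + 1 by positivity)]
    have hf : ∀ n : ℕ, ((n:ℝ) + 1) * (t ^ 3 * Real.exp (-(((n:ℝ) + 1) * t))) =
        t ^ 3 * (((n + 1 : ℕ) : ℝ) * Real.exp (-t) ^ (n + 1)) := by
      intro n
      rw [← Real.exp_nat_mul]
      push_cast
      ring_nf
    simp_rw [hf]
    rw [← ENNReal.ofReal_tsum_of_nonneg (fun n => by positivity) hs2.summable, hs2.tsum_eq]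
    congr 1
    rw [show 1 + (Real.exp t - 1) = Real.exp t by ring, Real.log_exp, Real.exp_neg]
    have : (1 - (Real.exp t)⁻¹) = (Real.exp t - 1) / Real.exp t := by field_simp
    rw [this]
    field_simp
  rw [setLIntegral_congr_fun measurableSet_Ioi h2, lintegral_tsum (fun n => by fun_prop)]
  have h3 : ∀ n : ℕ, ∫⁻ t in Ioi (0:ℝ), ENNReal.ofReal (((n:ℝ) + 1)) *
      ENNReal.ofReal (t ^ 3 * Real.exp (-(((n:ℝ) + 1) * t))) =
      ENNReal.ofReal (6 * ((1 : ℝ) / ((n : ℝ) + 1) ^ 3)) := by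
    intro n
    rw [lintegral_const_mul _ (by fun_prop), lint_pow (by positivity),
      ← ENNReal.ofReal_mul (by positivity)]
    congr 1
    field_simp
  simp_rw [h3]
  have hsum : Summable (fun n : ℕ => (1 : ℝ) / ((n : ℝ) + 1) ^ 3) := by
    have := (summable_nat_add_iff 1).2 (Real.summable_one_div_nat_pow.2 (show 1 < 3 by norm_num))
    simpa using this
  rw [← ENNReal.ofReal_tsum_of_nonneg (fun n => by positivity) (hsum.mul_left 6), tsum_mul_left]
lemma conn_iff (H : SimpleGraph (Fin 4)) : H.Connected ↔
    ∀ S : Finset (Fin 4), 0 ∈ S → (∀ a ∈ S, ∀ b, H.Adj a b → b ∈ S) → S = Finset.univ := by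
  constructor
  · intro h S h0 hS
    ext v
    simp only [Finset.mem_univ, iff_true]
    obtain ⟨w⟩ := h.preconnected 0 v
    have : ∀ u v : Fin 4, H.Walk u v → u ∈ S → v ∈ S := by
      intro u v w
      induction w with
      | nil => exact id
      | cons hadj _ ih => exact fun hu => ih (hS _ hu _ hadj)
    exact this _ _ w h0
  · intro h
    have := h (Finset.univ.filter fun v => H.Reachable 0 v) (by simp)
      (by
        intro a ha b hab
        simp only [Finset.mem_filter, Finset.mem_univ, true_and] at ha ⊢
        exact ha.trans hab.reachable)
    have h2 : ∀ v, H.Reachable 0 v := by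
      intro v
      have hv : v ∈ (Finset.univ : Finset (Fin 4)) := Finset.mem_univ v
      rw [← this] at hv
      simpa using hv
    exact (SimpleGraph.connected_iff _).2 ⟨fun u v => (h2 u).symm.trans (h2 v), inferInstance⟩

/-- edge labels -/
def ed : Fin 6 → Fin 4 × Fin 4 := ![(0,1),(0,2),(0,3),(1,3),(2,3),(1,2)]

def edg (i : Fin 6) : (⊤ : SimpleGraph (Fin 4)).edgeSet :=
  ⟨s((ed i).1, (ed i).2), by
    rw [SimpleGraph.mem_edgeSet, SimpleGraph.top_adj]; revert i; decide⟩

lemma edg_inj : Function.Injective edg := by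
  intro i j h
  have h := congrArg Subtype.val h
  simp only [edg] at h
  revert i j
  decide

lemma edg_surj : Function.Surjective edg := by
  rintro ⟨e, he⟩
  induction e with
  | _ a b =>
  rw [SimpleGraph.mem_edgeSet, SimpleGraph.top_adj] at he
  have : ∃ i, s((ed i).1, (ed i).2) = s(a, b) := by
    revert a b; decide
  obtain ⟨i, hi⟩ := this
  exact ⟨i, Subtype.ext hi⟩

noncomputable def edgE : Fin 6 ≃ (⊤ : SimpleGraph (Fin 4)).edgeSet :=
  Equiv.ofBijective edg ⟨edg_inj, edg_surj⟩

def adjB (T : Finset (Fin 6)) (a b : Fin 4) : Prop :=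
  ∃ i ∈ T, (ed i = (a, b) ∨ ed i = (b, a))

instance adjBdec (T : Finset (Fin 6)) (a b : Fin 4) : Decidable (adjB T a b) := by
  unfold adjB; infer_instance

def goodT (T : Finset (Fin 6)) : Prop := T.card = 3 ∧ T ≠ {0,1,5} ∧ T ≠ {0,2,3} ∧ T ≠ {1,2,4} ∧ T ≠ {3,4,5}

instance goodTdec (T : Finset (Fin 6)) : Decidable (goodT T) := by
  unfold goodT; infer_instance

set_option maxRecDepth 100000 in
set_option maxHeartbeats 4000000 in
lemma good_iff : ∀ T : Finset (Fin 6), goodT T ↔ T.card = 3 ∧ ∀ S : Finset (Fin 4), 0 ∈ S →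
    (∀ a ∈ S, ∀ b, adjB T a b → b ∈ S) → S = Finset.univ := by
  decide +kernel

lemma tree_iff (T : Finset (Fin 6)) :
    (SimpleGraph.fromEdgeSet (Subtype.val '' ((T.map edgE.toEmbedding : Finset _) :
      Set (⊤ : SimpleGraph (Fin 4)).edgeSet))).IsTree ↔ goodT T := by
  rw [SimpleGraph.isTree_iff_connected_and_card, conn_iff, good_iff, and_comm]
  refine and_congr ?_ ?_
  · have h : (SimpleGraph.fromEdgeSet (Subtype.val '' ((T.map edgE.toEmbedding : Finset _) :
      Set (⊤ : SimpleGraph (Fin 4)).edgeSet))).edgeSet = (Subtype.val '' ((T.map edgE.toEmbedding : Finset _) :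
      Set (⊤ : SimpleGraph (Fin 4)).edgeSet)) := by
      rw [SimpleGraph.edgeSet_fromEdgeSet, sdiff_eq_left]
      rw [Set.disjoint_left]
      rintro e ⟨⟨e', he'⟩, _, rfl⟩ hd
      exact SimpleGraph.not_isDiag_of_mem_edgeSet _ he' hd
    rw [h, Nat.card_image_of_injective Subtype.val_injective]
    have hc : Nat.card ((T.map edgE.toEmbedding : Finset _) :
      Set (⊤ : SimpleGraph (Fin 4)).edgeSet) = T.card := by
      rw [Nat.card_coe_set_eq, Set.ncard_coe_finset, Finset.card_map]
    rw [hc]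
    simp
  · have hadj : ∀ a b, (SimpleGraph.fromEdgeSet (Subtype.val '' ((T.map edgE.toEmbedding : Finset _) :
      Set (⊤ : SimpleGraph (Fin 4)).edgeSet))).Adj a b ↔ adjB T a b := by
      intro a b
      rw [SimpleGraph.fromEdgeSet_adj]
      have hne : ∀ i, (ed i).1 ≠ (ed i).2 := by decide
      simp only [adjB, Finset.coe_map, Set.mem_image, Finset.mem_coe]
      constructor
      · rintro ⟨⟨_, ⟨i, hi, rfl⟩, h⟩, _⟩
        refine ⟨i, hi, ?_⟩
        have h : s((ed i).1, (ed i).2) = s(a, b) := h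
        rw [Sym2.eq_iff] at h
        simpa [Prod.ext_iff] using h
      · rintro ⟨i, hi, h⟩
        refine ⟨⟨edg i, ⟨i, hi, rfl⟩, ?_⟩, ?_⟩
        · show s((ed i).1, (ed i).2) = s(a, b)
          rcases h with h | h <;> simp [h, Sym2.eq_swap]
        · have := hne i
          rcases h with h | h <;> simp [h] at this <;> tauto
    simp only [hadj]

def Psi (g : Fin 6 → ℝ) : ℝ :=
  g 4 * g 3 * g 5 + g 4 * g 3 * (g 0 + g 1) + g 4 * g 5 * (g 0 + g 2) + g 3 * g 5 * (g 1 + g 2)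
    + (g 4 + g 3 + g 5) * (g 0 * g 1 + g 0 * g 2 + g 1 * g 2)

def LL : List (Finset (Fin 6)) :=
  [{4,3,5},{4,3,0},{4,3,1},{4,5,0},{4,5,2},{3,5,1},{3,5,2},{4,0,1},{4,0,2},{4,1,2},
    {3,0,1},{3,0,2},{3,1,2},{5,0,1},{5,0,2},{5,1,2}]

lemma nodupL' : LL.Nodup := by
  decide +kernel

lemma nodupL : (LL : Multiset (Finset (Fin 6))).Nodup := Multiset.coe_nodup.2 nodupL'

lemma filtm : ∀ T : Finset (Fin 6), goodT Tᶜ ↔ T ∈ LL := by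
  decide +kernel

lemma filt : (Finset.univ.filter (fun T : Finset (Fin 6) => goodT Tᶜ)) =
   (⟨(LL : Multiset (Finset (Fin 6))), nodupL⟩ : Finset (Finset (Fin 6))) := by
  ext T
  rw [Finset.mem_filter, filtm]
  exact ⟨fun h => h.2, fun h => ⟨Finset.mem_univ _, h⟩⟩

lemma prod3 (h : Fin 6 → ℝ) (i j k : Fin 6) (hij : i ≠ j) (hik : i ≠ k) (hjk : j ≠ k) :
    ∏ a ∈ ({i, j, k} : Finset (Fin 6)), h a = h i * h j * h k := by
  rw [Finset.prod_insert (by simp [hij, hik]), Finset.prod_insert (by simp [hjk]),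
    Finset.prod_singleton, mul_assoc]

lemma aeval_graphPoly (f : (⊤ : SimpleGraph (Fin 4)).edgeSet → ℝ) :
    MvPolynomial.aeval f (graphPoly (⊤ : SimpleGraph (Fin 4))) = Psi (f ∘ edgE) := by
  unfold graphPoly
  rw [map_sum]
  have key : ∀ (inst : Fintype (⊤ : SimpleGraph (Fin 4)).edgeSet)
    (inst2 : DecidableEq (⊤ : SimpleGraph (Fin 4)).edgeSet)
    (dp : ∀ T : Finset (⊤ : SimpleGraph (Fin 4)).edgeSet, Decidable (SimpleGraph.fromEdgeSet
      (Subtype.val '' (T : Set (⊤ : SimpleGraph (Fin 4)).edgeSet))).IsTree),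
    (∑ T : Finset (⊤ : SimpleGraph (Fin 4)).edgeSet, MvPolynomial.aeval f
      (@ite _ (SimpleGraph.fromEdgeSet (Subtype.val '' (T : Set (⊤ : SimpleGraph (Fin 4)).edgeSet))).IsTree
        (dp T)
      (∏ e ∈ Tᶜ, (MvPolynomial.X e : MvPolynomial _ ℤ)) 0)) =
      ∑ T : Finset (Fin 6), if goodT Tᶜ then ∏ i ∈ T, f (edgE i) else 0 := by
    intro inst inst2 dp
    rw [← (Equiv.finsetCongr edgE).sum_comp]
    have h2 := Equiv.sum_comp (Function.Involutive.toPerm (compl : Finset (Fin 6) → Finset (Fin 6))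
      compl_involutive) (fun T => if goodT T then ∏ i ∈ Tᶜ, f (edgE i) else 0)
    simp only [Function.Involutive.coe_toPerm, compl_compl] at h2
    rw [h2]
    refine Finset.sum_congr rfl fun T _ => ?_
    have h3 := tree_iff T
    rw [← Equiv.finsetCongr_apply] at h3
    by_cases hT : goodT T
    · rw [if_pos (h3.2 hT), if_pos hT, map_prod]
      simp only [MvPolynomial.aeval_X]
      have : (Equiv.finsetCongr edgE T)ᶜ = Finset.map edgE.toEmbedding Tᶜ := by
        ext e
        obtain ⟨i, rfl⟩ := edgE.surjective e
        simp
      rw [this, Finset.prod_map]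
      rfl
    · rw [if_neg (fun h => hT (h3.1 h)), if_neg hT, map_zero]
  refine (key _ _ _).trans ?_
  rw [← Finset.sum_filter, filt]
  change ((LL : Multiset (Finset (Fin 6))).map (fun a => ∏ i ∈ a, f (edgE i))).sum = _
  rw [Multiset.map_coe, Multiset.sum_coe]
  simp only [LL, List.map_cons, List.map_nil, List.sum_cons, List.sum_nil]
  generalize hg : (fun i => f (edgE i)) = g
  have hg' : f ∘ edgE = g := hg
  have hg2 : ∀ i, f (edgE i) = g i := fun i => by rw [← hg]
  simp only [hg']
  iterate 16 rw [prod3 g _ _ _ (by decide) (by decide) (by decide)]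
  unfold Psi
  ring

def perms : Fin 6 → Equiv.Perm (Fin 6) := fun j =>
  ![Equiv.swap 0 5 * Equiv.swap 2 4, Equiv.swap 1 5 * Equiv.swap 2 3, Equiv.swap 2 5 * Equiv.swap 1 3,
    Equiv.swap 3 5 * Equiv.swap 1 2, Equiv.swap 4 5 * Equiv.swap 0 2, 1] j

lemma psi_symm (j : Fin 6) : ∃ τ : Equiv.Perm (Fin 6), τ 5 = j ∧ ∀ g, Psi (g ∘ τ) = Psi g := by
  refine ⟨perms j, by revert j; decide, fun g => ?_⟩
  have h : ∀ j k : Fin 6, (perms j k) = (![![5,1,4,3,2,0],![0,5,3,2,4,1],![0,3,5,1,4,2],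
    ![0,2,1,5,4,3],![2,1,0,3,5,4],![0,1,2,3,4,5]] : Fin 6 → Fin 6 → Fin 6) j k := by decide
  simp only [Psi, Function.comp_apply, h]
  fin_cases j <;> simp <;> ring
/-- log kernel -/
noncomputable def LK (r s : ℝ) : ℝ := Real.log ((1 + r) * (1 + s) / (1 + r + s))

lemma LK_nonneg {r s : ℝ} (hr : 0 < r) (hs : 0 < s) : 0 ≤ LK r s := by
  unfold LK
  apply Real.log_nonneg
  rw [le_div_iff₀ (by positivity)]
  nlinarith [mul_pos hr hs]

lemma LK_meas : Measurable (fun p : ℝ × ℝ => LK p.1 p.2) := by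
  unfold LK; fun_prop

lemma LK_comp {α : Type*} [MeasurableSpace α] {f g : α → ℝ} (hf : Measurable f)
    (hg : Measurable g) : Measurable (fun a => LK (f a) (g a)) :=
  LK_meas.comp (hf.prodMk hg)

/-- integrate x1, x2 -/
lemma step12 {r s y : ℝ} (hr : 0 < r) (hs : 0 < s) (hy : 0 < y) :
    ∫⁻ x2 in Ioi (0:ℝ), ∫⁻ x1 in Ioi (0:ℝ),
      ENNReal.ofReal (1 / (Psi ![r, s, y, x2, x1, 1]) ^ 2) =
    ENNReal.ofReal (Real.log ((y * (1 + r + s) + r * s + r) * (y * (1 + r + s) + r * s + s)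
      / ((1 + r + s) * (r * s + y * (r + s)))) / (y * (1 + r + s) + r * s) ^ 2) := by
  have h1 : ∀ x2 ∈ Ioi (0:ℝ), ∫⁻ x1 in Ioi (0:ℝ),
      ENNReal.ofReal (1 / (Psi ![r, s, y, x2, x1, 1]) ^ 2) =
      ENNReal.ofReal (1 / (((1 + r + s) * x2 + (y * (1 + r + s) + r * s + r)) *
        ((y * (1 + r + s) + r * s + s) * x2 + (r * s + y * (r + s))))) := by
    intro x2 hx2
    have hx2 : 0 < x2 := hx2
    rw [← lint_sq (by positivity) (by positivity)]
    refine lintegral_congr fun x1 => ?_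
    congr 3
    simp [Psi]
    ring
  rw [setLIntegral_congr_fun measurableSet_Ioi h1, lint_two (d := (y * (1 + r + s) + r * s) ^ 2)]
  all_goals first | positivity | ring

lemma step3 {r s : ℝ} (hr : 0 < r) (hs : 0 < s) :
    ∫⁻ y in Ioi (0:ℝ), ENNReal.ofReal (Real.log ((y * (1 + r + s) + r * s + r) *
      (y * (1 + r + s) + r * s + s) / ((1 + r + s) * (r * s + y * (r + s)))) /
        (y * (1 + r + s) + r * s) ^ 2) =
    ∫⁻ j in Ioi (0:ℝ), ENNReal.ofReal (LK ((1 + j) * r) ((1 + j) * s) /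
      ((1 + r + s) * (r * s) * (1 + j) ^ 2)) := by
  have hc : 0 < r * s / (1 + r + s) := by positivity
  rw [lint_scale hc]
  refine setLIntegral_congr_fun measurableSet_Ioi fun j hj => ?_
  have hj : 0 < j := hj
  try simp only
  rw [← ENNReal.ofReal_mul hc.le]
  congr 1
  have e1 : r * s / (1 + r + s) * j * (1 + r + s) + r * s = r * s * (1 + j) := by
    field_simp; ring
  have e2 : (1 + r + s) * (r * s + r * s / (1 + r + s) * j * (r + s)) =
      r * s * (1 + (1 + j) * r + (1 + j) * s) := by
    field_simp; ring
  rw [e1, e2]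
  have e3 : (r * s * (1 + j) + r) * (r * s * (1 + j) + s) /
      (r * s * (1 + (1 + j) * r + (1 + j) * s)) =
      (1 + (1 + j) * r) * (1 + (1 + j) * s) / (1 + (1 + j) * r + (1 + j) * s) := by
    field_simp; ring
  rw [e3]
  unfold LK
  field_simp

lemma step4 :
    ∫⁻ r in Ioi (0:ℝ), ∫⁻ s in Ioi (0:ℝ), ∫⁻ j in Ioi (0:ℝ),
      ENNReal.ofReal (LK ((1 + j) * r) ((1 + j) * s) / ((1 + r + s) * (r * s) * (1 + j) ^ 2)) =
    ∫⁻ r in Ioi (0:ℝ), ∫⁻ s in Ioi (0:ℝ),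
      ENNReal.ofReal (LK r s * Real.log (1 + r + s) / (r * s * (r + s))) := by
  have hm1 : Measurable (fun p : (ℝ × ℝ) × ℝ => ENNReal.ofReal
      (LK ((1 + p.2) * p.1.1) ((1 + p.2) * p.1.2) /
        ((1 + p.1.1 + p.1.2) * (p.1.1 * p.1.2) * (1 + p.2) ^ 2))) := by
    have : Measurable (fun p : (ℝ × ℝ) × ℝ => LK ((1 + p.2) * p.1.1) ((1 + p.2) * p.1.2)) :=
      LK_comp (by fun_prop) (by fun_prop)
    fun_prop
  have hm2 : Measurable (fun p : (ℝ × ℝ) × ℝ => ENNReal.ofReal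
      (LK p.1.1 p.1.2 / (p.1.1 * p.1.2) *
        (1 / ((1 * p.2 + (1 + p.1.1 + p.1.2)) * (1 * p.2 + 1))))) := by
    have : Measurable (fun p : (ℝ × ℝ) × ℝ => LK p.1.1 p.1.2) :=
      LK_comp (by fun_prop) (by fun_prop)
    fun_prop
  -- general swap
  have swap3 : ∀ F : (ℝ × ℝ) × ℝ → ENNReal, Measurable F →
      ∫⁻ r in Ioi (0:ℝ), ∫⁻ s in Ioi (0:ℝ), ∫⁻ j in Ioi (0:ℝ), F ((r, s), j) =
      ∫⁻ j in Ioi (0:ℝ), ∫⁻ r in Ioi (0:ℝ), ∫⁻ s in Ioi (0:ℝ), F ((r, s), j) := by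
    intro F hF
    have a : ∀ r, ∫⁻ s in Ioi (0:ℝ), ∫⁻ j in Ioi (0:ℝ), F ((r, s), j) =
        ∫⁻ j in Ioi (0:ℝ), ∫⁻ s in Ioi (0:ℝ), F ((r, s), j) := by
      intro r
      refine lintegral_lintegral_swap (Measurable.aemeasurable ?_)
      exact hF.comp (by fun_prop : Measurable fun q : ℝ × ℝ => ((r, q.1), q.2))
    simp_rw [a]
    refine lintegral_lintegral_swap (Measurable.aemeasurable ?_)
    have := hF.comp (by fun_prop : Measurable fun q : (ℝ × ℝ) × ℝ => ((q.1.1, q.2), q.1.2))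
    exact this.lintegral_prod_right' (ν := volume.restrict (Ioi (0:ℝ)))
  rw [swap3 _ hm1]
  have h2 : ∀ j ∈ Ioi (0:ℝ), ∫⁻ r in Ioi (0:ℝ), ∫⁻ s in Ioi (0:ℝ),
      ENNReal.ofReal (LK ((1 + j) * r) ((1 + j) * s) / ((1 + r + s) * (r * s) * (1 + j) ^ 2)) =
      ∫⁻ r in Ioi (0:ℝ), ∫⁻ s in Ioi (0:ℝ), ENNReal.ofReal
      (LK r s / (r * s) * (1 / ((1 * j + (1 + r + s)) * (1 * j + 1)))) := by
    intro j hj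
    have hj : 0 < j := hj
    have hk : 0 < 1 / (1 + j) := by positivity
    rw [lint_scale hk]
    refine setLIntegral_congr_fun measurableSet_Ioi fun r hr => ?_
    have hr : 0 < r := hr
    try simp only
    rw [lint_scale hk, ← lintegral_const_mul' _ _ ENNReal.ofReal_ne_top]
    refine setLIntegral_congr_fun measurableSet_Ioi fun s hs => ?_
    have hs : 0 < s := hs
    try simp only
    rw [← ENNReal.ofReal_mul hk.le, ← ENNReal.ofReal_mul hk.le]
    congr 1
    rw [show (1 + j) * (1 / (1 + j) * r) = r by field_simp,
      show (1 + j) * (1 / (1 + j) * s) = s by field_simp]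
    field_simp
    ring
  rw [setLIntegral_congr_fun measurableSet_Ioi h2, ← swap3 _ hm2]
  refine setLIntegral_congr_fun measurableSet_Ioi fun r hr => ?_
  refine setLIntegral_congr_fun measurableSet_Ioi fun s hs => ?_
  have hr : 0 < r := hr
  have hs : 0 < s := hs
  have h0 := LK_nonneg hr hs
  have h3 : ∀ j, ENNReal.ofReal
      (LK r s / (r * s) * (1 / ((1 * j + (1 + r + s)) * (1 * j + 1)))) =
      ENNReal.ofReal (LK r s / (r * s)) *
        ENNReal.ofReal (1 / ((1 * j + (1 + r + s)) * (1 * j + 1))) :=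
    fun j => ENNReal.ofReal_mul (by positivity)
  simp only [h3]
  rw [lintegral_const_mul' _ _ ENNReal.ofReal_ne_top, lint_two (d := r + s) (by positivity)
    one_pos one_pos one_pos (by positivity) (by ring), ← ENNReal.ofReal_mul (by positivity)]
  congr 1
  simp only [mul_one, div_one]
  field_simp

lemma LK_int {r N : ℝ} (hr : 0 < r) (hN : r < N) :
    ENNReal.ofReal (LK r (N - r) / r) =
      ∫⁻ M in Ioo r N, ENNReal.ofReal (1 / ((1 + M - r) * (1 + M))) := by
  have := ftcIoo (g := fun M => Real.log ((1 + M - r) / (1 + M)) / r)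
    (g' := fun M => 1 / ((1 + M - r) * (1 + M))) hN.le ?_ ?_
  · rw [this]
    congr 1
    unfold LK
    rw [← sub_div, ← Real.log_div, show 1 + r + (N - r) = 1 + N by ring]
    · congr 2
      rw [show 1 + r - r = 1 by ring]
      have : 1 + N ≠ 0 := by linarith
      field_simp
      ring
    · have : 0 < 1 + N - r := by linarith
      have : 0 < 1 + N := by linarith
      positivity
    · rw [show 1 + r - r = 1 by ring]
      positivity
  · intro M hM
    have hp : 0 < 1 + M - r := by linarith [hM.1]
    have hq : 0 < 1 + M := by linarith [hM.1]
    have d1 : HasDerivAt (fun M => 1 + M - r) 1 M := by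
      simpa using ((hasDerivAt_id M).const_add 1).sub_const r
    have d2 : HasDerivAt (fun M => 1 + M) 1 M := by
      simpa using ((hasDerivAt_id M).const_add 1)
    refine (((d1.div d2 hq.ne').log (div_ne_zero hp.ne' hq.ne')).div_const r).congr_deriv ?_
    simp only [Pi.div_apply]
    field_simp
    ring
  · intro M hM
    have hp : 0 < 1 + M - r := by linarith [hM.1]
    have hq : 0 < 1 + M := by linarith [hM.1]
    positivity

lemma inner_r {M : ℝ} (hM : 0 < M) :
    ∫⁻ r in Ioo 0 M, ENNReal.ofReal (1 / ((1 + M - r) * (1 + M))) =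
      ENNReal.ofReal (Real.log (1 + M) / (1 + M)) := by
  have := ftcIoo (g := fun r => - Real.log (1 + M - r) / (1 + M))
    (g' := fun r => 1 / ((1 + M - r) * (1 + M))) hM.le ?_ ?_
  · rw [this]
    congr 1
    simp
    ring
  · intro r hr
    have hp : 0 < 1 + M - r := by linarith [hr.2]
    have d1 : HasDerivAt (fun r => 1 + M - r) (-1) r := by
      simpa using ((hasDerivAt_id r).const_sub (1 + M))
    refine ((d1.log hp.ne').neg.div_const (1 + M)).congr_deriv ?_
    field_simp
  · intro r hr
    have hp : 0 < 1 + M - r := by linarith [hr.2]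
    positivity

lemma inner_M {N : ℝ} (hN : 0 < N) :
    ∫⁻ M in Ioo 0 N, ENNReal.ofReal (Real.log (1 + M) / (1 + M)) =
      ENNReal.ofReal (Real.log (1 + N) ^ 2 / 2) := by
  have := ftcIoo (g := fun M => Real.log (1 + M) ^ 2 / 2)
    (g' := fun M => Real.log (1 + M) / (1 + M)) hN.le ?_ ?_
  · rw [this]
    simp
  · intro M hM
    have hp : 0 < 1 + M := by linarith [hM.1]
    have d1 : HasDerivAt (fun M => 1 + M) 1 M := by
      simpa using ((hasDerivAt_id M).const_add 1)
    refine (((d1.log hp.ne').pow 2).div_const 2).congr_deriv ?_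
    field_simp
    simp
  · intro M hM
    have hp : 0 ≤ Real.log (1 + M) := Real.log_nonneg (by linarith [hM.1])
    have := hM.1
    positivity

lemma gN {N : ℝ} (hN : 0 < N) :
    ∫⁻ r in Ioo 0 N, ENNReal.ofReal (LK r (N - r) / r) =
      ENNReal.ofReal (Real.log (1 + N) ^ 2 / 2) := by
  rw [setLIntegral_congr_fun measurableSet_Ioo (fun r hr => LK_int hr.1 hr.2)]
  have h := tri_swap (volume.restrict (Ioo 0 N))
    (fun r M => ENNReal.ofReal (1 / ((1 + M - r) * (1 + M)))) (by fun_prop)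
  have e1 : ∀ r ∈ Ioo 0 N, ∫⁻ M in Ioi r, ENNReal.ofReal (1 / ((1 + M - r) * (1 + M)))
      ∂(volume.restrict (Ioo 0 N)) =
      ∫⁻ M in Ioo r N, ENNReal.ofReal (1 / ((1 + M - r) * (1 + M))) := by
    intro r hr
    rw [Measure.restrict_restrict measurableSet_Ioi]
    congr 2
    ext x
    simp only [mem_inter_iff, mem_Ioi, mem_Ioo]
    have := hr.1
    constructor
    · rintro ⟨a, b, c⟩; exact ⟨a, c⟩
    · rintro ⟨a, c⟩; exact ⟨a, by linarith, c⟩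
  have e2 : ∀ M ∈ Ioo 0 N, ∫⁻ r in Iio M, ENNReal.ofReal (1 / ((1 + M - r) * (1 + M)))
      ∂(volume.restrict (Ioo 0 N)) = ENNReal.ofReal (Real.log (1 + M) / (1 + M)) := by
    intro M hM
    rw [Measure.restrict_restrict measurableSet_Iio, ← inner_r hM.1]
    congr 2
    ext x
    simp only [mem_inter_iff, mem_Iio, mem_Ioo]
    have := hM.2
    constructor
    · rintro ⟨a, b, c⟩; exact ⟨b, a⟩
    · rintro ⟨a, c⟩; exact ⟨c, a, by linarith⟩
  rw [setLIntegral_congr_fun measurableSet_Ioo e1, setLIntegral_congr_fun measurableSet_Ioo e2,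
    inner_M hN] at h
  exact h

lemma step5 :
    ∫⁻ r in Ioi (0:ℝ), ∫⁻ s in Ioi (0:ℝ),
      ENNReal.ofReal (LK r s * Real.log (1 + r + s) / (r * (r + s) ^ 2)) =
    ∫⁻ N in Ioi (0:ℝ), ENNReal.ofReal (Real.log (1 + N) ^ 3 / N ^ 2 / 2) := by
  have h1 : ∀ r ∈ Ioi (0:ℝ), ∫⁻ s in Ioi (0:ℝ),
      ENNReal.ofReal (LK r s * Real.log (1 + r + s) / (r * (r + s) ^ 2)) =
      ∫⁻ N in Ioi r, ENNReal.ofReal (LK r (N - r) * Real.log (1 + N) / (r * N ^ 2))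
        ∂(volume.restrict (Ioi 0)) := by
    intro r hr
    have hr : 0 < r := hr
    rw [Measure.restrict_restrict measurableSet_Ioi, inter_eq_left.2 (Ioi_subset_Ioi hr.le),
      ← lint_shift r]
    refine lintegral_congr fun s => ?_
    rw [show r + s - r = s by ring, show 1 + (r + s) = 1 + r + s by ring]
  have hm : Measurable (Function.uncurry fun r N : ℝ =>
      ENNReal.ofReal (LK r (N - r) * Real.log (1 + N) / (r * N ^ 2))) := by
    have : Measurable (fun p : ℝ × ℝ => LK p.1 (p.2 - p.1)) :=
      LK_comp (by fun_prop) (by fun_prop)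
    unfold Function.uncurry
    fun_prop
  rw [setLIntegral_congr_fun measurableSet_Ioi h1, tri_swap _ _ hm]
  refine setLIntegral_congr_fun measurableSet_Ioi fun N hN => ?_
  have hN : 0 < N := hN
  have hl : 0 ≤ Real.log (1 + N) := Real.log_nonneg (by linarith)
  try simp only
  rw [Measure.restrict_restrict measurableSet_Iio, Iio_inter_Ioi]
  have h2 : ∀ r, ENNReal.ofReal (LK r (N - r) * Real.log (1 + N) / (r * N ^ 2)) =
      ENNReal.ofReal (Real.log (1 + N) / N ^ 2) * ENNReal.ofReal (LK r (N - r) / r) := by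
    intro r
    rw [← ENNReal.ofReal_mul (by positivity)]
    congr 1
    rw [div_mul_div_comm, mul_comm r, mul_comm (LK _ _)]
  simp only [h2]
  rw [lintegral_const_mul' _ _ ENNReal.ofReal_ne_top, gN hN, ← ENNReal.ofReal_mul (by positivity)]
  congr 1
  ring

lemma LK_comm (r s : ℝ) : LK r s = LK s r := by
  unfold LK; congr 1; ring

lemma step6 :
    ∫⁻ r in Ioi (0:ℝ), ∫⁻ s in Ioi (0:ℝ),
      ENNReal.ofReal (LK r s * Real.log (1 + r + s) / (r * s * (r + s))) =
    ∫⁻ N in Ioi (0:ℝ), ENNReal.ofReal (Real.log (1 + N) ^ 3 / N ^ 2) := by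
  have hm : Measurable (fun p : ℝ × ℝ =>
      ENNReal.ofReal (LK p.1 p.2 * Real.log (1 + p.1 + p.2) / (p.1 * (p.1 + p.2) ^ 2))) := by
    have : Measurable (fun p : ℝ × ℝ => LK p.1 p.2) := LK_meas
    fun_prop
  have h1 : ∀ r ∈ Ioi (0:ℝ), ∫⁻ s in Ioi (0:ℝ),
      ENNReal.ofReal (LK r s * Real.log (1 + r + s) / (r * s * (r + s))) =
      (∫⁻ s in Ioi (0:ℝ),
        ENNReal.ofReal (LK r s * Real.log (1 + r + s) / (r * (r + s) ^ 2))) +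
      ∫⁻ s in Ioi (0:ℝ),
        ENNReal.ofReal (LK s r * Real.log (1 + s + r) / (s * (s + r) ^ 2)) := by
    intro r hr
    have hr : 0 < r := hr
    have hms : Measurable (fun s : ℝ =>
      ENNReal.ofReal (LK r s * Real.log (1 + r + s) / (r * (r + s) ^ 2))) := by
      have : Measurable (fun s : ℝ => LK r s) := LK_comp (by fun_prop) (by fun_prop)
      fun_prop
    rw [← lintegral_add_left hms (fun s =>
      ENNReal.ofReal (LK s r * Real.log (1 + s + r) / (s * (s + r) ^ 2)))]
    refine setLIntegral_congr_fun measurableSet_Ioi fun s hs => ?_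
    have hs : 0 < s := hs
    have h0 := LK_nonneg hr hs
    have h0' := LK_nonneg hs hr
    have hl : 0 ≤ Real.log (1 + r + s) := Real.log_nonneg (by linarith)
    have hl' : 0 ≤ Real.log (1 + s + r) := Real.log_nonneg (by linarith)
    try simp only [Function.comp_apply]
    rw [← ENNReal.ofReal_add (by positivity) (by positivity), LK_comm s r,
      show 1 + s + r = 1 + r + s by ring, show s + r = r + s by ring]
    congr 1
    field_simp
    ring
  rw [setLIntegral_congr_fun measurableSet_Ioi h1, lintegral_add_left
    (hm.lintegral_prod_right' (ν := volume.restrict (Ioi (0:ℝ)))),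
    lintegral_lintegral_swap
      (f := fun r s => ENNReal.ofReal (LK s r * Real.log (1 + s + r) / (s * (s + r) ^ 2)))
      (hm.comp measurable_swap).aemeasurable, step5, ← lintegral_add_left (by fun_prop)]
  refine setLIntegral_congr_fun measurableSet_Ioi fun N hN => ?_
  have hN : 0 < N := hN
  have hl : 0 ≤ Real.log (1 + N) := Real.log_nonneg (by linarith)
  try simp only
  rw [← ENNReal.ofReal_add (by positivity) (by positivity)]
  congr 1
  ring

lemma main_lint :
    ∫⁻ r in Ioi (0:ℝ), ∫⁻ s in Ioi (0:ℝ), ∫⁻ y in Ioi (0:ℝ), ∫⁻ x2 in Ioi (0:ℝ),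
      ∫⁻ x1 in Ioi (0:ℝ), ENNReal.ofReal (1 / (Psi ![r, s, y, x2, x1, 1]) ^ 2) =
      ENNReal.ofReal (6 * ∑' n : ℕ, (1 : ℝ) / ((n : ℝ) + 1) ^ 3) := by
  rw [← lint_final, ← step6, ← step4]
  refine setLIntegral_congr_fun measurableSet_Ioi fun r hr => ?_
  refine setLIntegral_congr_fun measurableSet_Ioi fun s hs => ?_
  try simp only
  rw [← step3 hr hs]
  refine setLIntegral_congr_fun measurableSet_Ioi fun y hy => ?_
  exact step12 hr hs hy
lemma lint_cons {n : ℕ} (F : (Fin (n + 1) → ℝ) → ENNReal) (hF : Measurable F) :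
    ∫⁻ x, F x ∂(Measure.pi fun _ : Fin (n + 1) => volume.restrict (Ioi (0:ℝ))) =
    ∫⁻ a in Ioi (0:ℝ), ∫⁻ x, F (Fin.cons a x)
      ∂(Measure.pi fun _ : Fin n => volume.restrict (Ioi (0:ℝ))) := by
  have h := (measurePreserving_piFinSuccAbove
    (fun _ : Fin (n + 1) => volume.restrict (Ioi (0:ℝ))) 0).symm
  have h2 : Measurable (fun a => F ((MeasurableEquiv.piFinSuccAbove (fun _ => ℝ) 0).symm a)) :=
    hF.comp h.measurable
  rw [← h.lintegral_comp hF, lintegral_prod _ h2.aemeasurable]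
  refine lintegral_congr fun a => lintegral_congr fun x => ?_
  congr 1
  funext i
  refine Fin.cases ?_ (fun j => ?_) i <;> simp [MeasurableEquiv.piFinSuccAbove]

lemma cons_meas {n : ℕ} {F : (Fin (n + 1) → ℝ) → ENNReal} (hF : Measurable F) (a : ℝ) :
    Measurable (fun x : Fin n → ℝ => F (Fin.cons a x)) := by
  refine hF.comp (measurable_pi_lambda _ fun i => ?_)
  refine Fin.cases ?_ (fun j => ?_) i
  · simp
  · simpa using measurable_pi_apply j

lemma lint5 (F : (Fin 5 → ℝ) → ENNReal) (hF : Measurable F) :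
    ∫⁻ x, F x ∂(Measure.pi fun _ : Fin 5 => volume.restrict (Ioi (0:ℝ))) =
    ∫⁻ r in Ioi (0:ℝ), ∫⁻ s in Ioi (0:ℝ), ∫⁻ y in Ioi (0:ℝ), ∫⁻ x2 in Ioi (0:ℝ),
      ∫⁻ x1 in Ioi (0:ℝ), F ![r, s, y, x2, x1] := by
  rw [lint_cons F hF]
  refine lintegral_congr fun r => ?_
  have h1 := cons_meas hF r
  rw [lint_cons _ h1]
  refine lintegral_congr fun s => ?_
  have h2 := cons_meas h1 s
  rw [lint_cons _ h2]
  refine lintegral_congr fun y => ?_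
  have h3 := cons_meas h2 y
  rw [lint_cons _ h3]
  refine lintegral_congr fun x2 => ?_
  have h4 := cons_meas h3 x2
  rw [lint_cons _ h4]
  refine lintegral_congr fun x1 => ?_
  rw [Measure.pi_of_empty, lintegral_dirac]
  congr 1

lemma Psi_meas : Measurable (fun x : Fin 5 → ℝ => Psi ![x 0, x 1, x 2, x 3, x 4, 1]) := by
  simp only [Psi]
  simp only [Matrix.cons_val]
  fun_prop

lemma finsplit (σ : Fin 6 ≃ (⊤ : SimpleGraph (Fin 4)).edgeSet) (e₀ : (⊤ : SimpleGraph (Fin 4)).edgeSet)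
    (h5 : σ 5 = e₀) : ∃ ε : Fin 5 ≃ {e : (⊤ : SimpleGraph (Fin 4)).edgeSet // e ≠ e₀},
      ∀ i, (ε i).1 = σ i.castSucc := by
  refine ⟨Equiv.ofBijective (fun i => ⟨σ i.castSucc, ?_⟩) ⟨?_, ?_⟩, fun i => rfl⟩
  · rw [← h5]
    intro h
    have hd : ∀ i : Fin 5, i.castSucc ≠ (5 : Fin 6) := by decide
    exact hd i (σ.injective h)
  · intro i j h
    have h := σ.injective (congrArg Subtype.val h)
    exact Fin.castSucc_injective _ h
  · rintro ⟨e, he⟩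
    obtain ⟨k, rfl⟩ := σ.surjective e
    have hk : k ≠ Fin.last 5 := by
      rintro rfl
      exact he h5
    obtain ⟨i, rfl⟩ := Fin.exists_castSucc_eq.2 hk
    exact ⟨i, rfl⟩

lemma period_aux (e₀ : (⊤ : SimpleGraph (Fin 4)).edgeSet)
    (inst : Fintype {e : (⊤ : SimpleGraph (Fin 4)).edgeSet // e ≠ e₀}) :
    ∫ x in (Set.univ.pi fun _ : {e : (⊤ : SimpleGraph (Fin 4)).edgeSet // e ≠ e₀} => Set.Ioi (0 : ℝ)),
    1 / (MvPolynomial.aeval (fun e : (⊤ : SimpleGraph (Fin 4)).edgeSet =>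
      if h : e = e₀ then (1 : ℝ) else x ⟨e, h⟩) (graphPoly (⊤ : SimpleGraph (Fin 4)))) ^ 2 =
      6 * ∑' n : ℕ, (1 : ℝ) / ((n : ℝ) + 1) ^ 3 := by
  obtain ⟨τ, hτ, hsymm⟩ := psi_symm (edgE.symm e₀)
  set σ : Fin 6 ≃ (⊤ : SimpleGraph (Fin 4)).edgeSet := τ.trans edgE with hσ
  have h5 : σ 5 = e₀ := by simp [hσ, hτ]
  obtain ⟨ε, hε⟩ := finsplit σ e₀ h5
  rw [volume_pi, Measure.restrict_pi_pi]
  have hpsi : ∀ x : {e : (⊤ : SimpleGraph (Fin 4)).edgeSet // e ≠ e₀} → ℝ,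
      MvPolynomial.aeval (fun e : (⊤ : SimpleGraph (Fin 4)).edgeSet =>
        if h : e = e₀ then (1 : ℝ) else x ⟨e, h⟩) (graphPoly (⊤ : SimpleGraph (Fin 4))) =
      Psi ![x (ε 0), x (ε 1), x (ε 2), x (ε 3), x (ε 4), 1] := by
    intro x
    rw [aeval_graphPoly, ← hsymm]
    congr 1
    have hlast : ∀ i : Fin 5, (fun e : (⊤ : SimpleGraph (Fin 4)).edgeSet =>
        if h : e = e₀ then (1 : ℝ) else x ⟨e, h⟩) (σ i.castSucc) = x (ε i) := by
      intro i
      have hne : σ i.castSucc ≠ e₀ := by rw [← hε]; exact (ε i).2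
      simp only [dif_neg hne]
      congr 1
      exact Subtype.ext (hε i).symm
    funext k
    refine Fin.lastCases ?_ (fun i => ?_) k
    · show (fun e : (⊤ : SimpleGraph (Fin 4)).edgeSet =>
        if h : e = e₀ then (1 : ℝ) else x ⟨e, h⟩) (σ 5) = _
      simp only [dif_pos h5]
      rfl
    · refine (hlast i).trans ?_
      fin_cases i <;> rfl
  simp_rw [hpsi]
  have hmp := measurePreserving_piCongrLeft (α := fun _ : {e : (⊤ : SimpleGraph (Fin 4)).edgeSet // e ≠ e₀} => ℝ)
    (fun _ => volume.restrict (Ioi (0:ℝ))) ε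
  rw [← hmp.integral_comp']
  have hap : ∀ (x : Fin 5 → ℝ) (i : Fin 5), (MeasurableEquiv.piCongrLeft
      (fun _ : {e : (⊤ : SimpleGraph (Fin 4)).edgeSet // e ≠ e₀} => ℝ) ε) x (ε i) = x i := by
    intro x i
    exact Equiv.piCongrLeft_apply_apply (P := fun _ => ℝ) ε x i
  simp_rw [hap]
  have hmeas : Measurable (fun x : Fin 5 → ℝ => 1 / Psi ![x 0, x 1, x 2, x 3, x 4, 1] ^ 2) :=
    measurable_const.div (Psi_meas.pow_const 2)
  rw [integral_eq_lintegral_of_nonneg_ae (Eventually.of_forall fun x => by positivity)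
    hmeas.aestronglyMeasurable, lint5 _ hmeas.ennreal_ofReal]
  have := main_lint
  refine (congrArg ENNReal.toReal this).trans ?_
  exact ENNReal.toReal_ofReal (mul_nonneg (by norm_num) (tsum_nonneg fun n => by positivity))

theorem stmt19 (e₀ : (⊤ : SimpleGraph (Fin 4)).edgeSet) :
    graphPeriod (⊤ : SimpleGraph (Fin 4)) e₀ =
      6 * ∑' n : ℕ, (1 : ℝ) / ((n : ℝ) + 1) ^ 3 := by
  unfold graphPeriod
  convert period_aux e₀ _
end
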